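/- arXiv:2412.07952 — 3 statements merged into one kernel-verified Lean document; each statement's English description precedes it below -/
import Mathlib

section
/- The expected volume of the tetrahedron spanned by four i.i.d. uniform random points in the unit cube equals 3977/216000 − π²/2160. -/
open MeasureTheory

/-- The integral of `(p q)⁻ᵏ` along the segment `p + q = 1 + t`, `t ≤ p ≤ 1`: reduction formula. -/
lemma integral_inv_mul_pow_succ {t : ℝ} (ht : 0 < t) (ht1 : t ≤ 1) {k : ℕ} (hk : 0 < k) :
    ∫ p in t..1, ((p * (1 + t - p))⁻¹) ^ (k + 1)
      = (2 * (1 - t) * t⁻¹ ^ k + (4 * k - 2) * ∫ p in t..1, ((p * (1 + t - p))⁻¹) ^ k)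
        / (k * (1 + t) ^ 2) := by
  have hpos : ∀ p ∈ Set.uIcc t 1, 0 < p ∧ 0 < 1 + t - p := by
    intro p hp
    rw [Set.uIcc_of_le ht1] at hp
    exact ⟨by linarith [hp.1], by linarith [hp.2]⟩
  have hint : ∀ j : ℕ, IntervalIntegrable (fun p : ℝ => ((p * (1 + t - p))⁻¹) ^ j) volume t 1 := by
    intro j
    apply ContinuousOn.intervalIntegrable
    refine ContinuousOn.pow (ContinuousOn.inv₀ (by fun_prop) ?_) j
    intro p hp
    exact (mul_pos (hpos p hp).1 (hpos p hp).2).ne'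
  have hd : ∀ p ∈ Set.uIcc t 1,
      HasDerivAt (fun p : ℝ => (2 * p - (1 + t)) * ((p * (1 + t - p))⁻¹) ^ k)
        ((2 - 4 * k) * ((p * (1 + t - p))⁻¹) ^ k
          + k * (1 + t) ^ 2 * ((p * (1 + t - p))⁻¹) ^ (k + 1)) p := by
    intro p hp
    obtain ⟨h1, h2⟩ := hpos p hp
    have e1 : HasDerivAt (fun p : ℝ => p * (1 + t - p)) (1 + t - 2 * p) p := by
      have := (hasDerivAt_id p).mul ((hasDerivAt_id p).const_sub (1 + t))
      exact this.congr_deriv (by simp only [id]; ring)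
    have e2 := (e1.inv (mul_pos h1 h2).ne').pow k
    have e3 : HasDerivAt (fun p : ℝ => 2 * p - (1 + t)) 2 p := by
      simpa using ((hasDerivAt_id p).const_mul 2).sub_const (1 + t)
    have e4 := e3.mul e2
    refine e4.congr_deriv ?_
    obtain ⟨j, rfl⟩ : ∃ j, k = j + 1 := ⟨k - 1, by omega⟩
    have := h1.ne'
    have := h2.ne'
    simp only [Nat.add_sub_cancel]
    generalize hm : (p * (1 + t - p))⁻¹ = m
    have hm1 : m * (p * (1 + t - p)) = 1 := by rw [← hm]; field_simp
    have : -(1 + t - 2 * p) / (p * (1 + t - p)) ^ 2 = -(1 + t - 2 * p) * m ^ 2 := by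
      rw [← hm]; field_simp
    simp only [Pi.inv_apply, Pi.pow_apply, hm, this]
    push_cast
    linear_combination (-4 * (j + 1) * m ^ (j + 1)) * hm1
  have h := intervalIntegral.integral_eq_sub_of_hasDerivAt hd
    (((hint k).const_mul _).add ((hint (k + 1)).const_mul _))
  rw [intervalIntegral.integral_add ((hint k).const_mul _) ((hint (k + 1)).const_mul _),
    intervalIntegral.integral_const_mul, intervalIntegral.integral_const_mul] at h
  have hk' : (k : ℝ) ≠ 0 := by exact_mod_cast hk.ne'
  have hc : 1 + t ≠ 0 := by positivity
  rw [eq_div_iff (by positivity)]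
  have e1 : (1 * (1 + t - 1) : ℝ)⁻¹ = t⁻¹ := by congr 1; ring
  have e2 : (t * (1 + t - t) : ℝ)⁻¹ = t⁻¹ := by congr 1; ring
  rw [e1, e2] at h
  linear_combination h

lemma integral_inv_mul {t : ℝ} (ht : 0 < t) (ht1 : t ≤ 1) :
    ∫ p in t..1, ((p * (1 + t - p))⁻¹) ^ 1 = -2 * Real.log t / (1 + t) := by
  have hpos : ∀ p ∈ Set.uIcc t 1, 0 < p ∧ 0 < 1 + t - p := by
    intro p hp
    rw [Set.uIcc_of_le ht1] at hp
    exact ⟨by linarith [hp.1], by linarith [hp.2]⟩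
  have hc : 1 + t ≠ 0 := by positivity
  have hd : ∀ p ∈ Set.uIcc t 1,
      HasDerivAt (fun p : ℝ => (Real.log p - Real.log (1 + t - p)) / (1 + t))
        (((p * (1 + t - p))⁻¹) ^ 1) p := by
    intro p hp
    obtain ⟨h1, h2⟩ := hpos p hp
    have := h1.ne'
    have := h2.ne'
    have e := ((Real.hasDerivAt_log h1.ne').sub
      (((hasDerivAt_id p).const_sub (1 + t)).log h2.ne')).div_const (1 + t)
    refine e.congr_deriv ?_
    simp only [id]
    field_simp
    ring
  rw [intervalIntegral.integral_eq_sub_of_hasDerivAt hd]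
  · simp only [add_sub_cancel_left, add_sub_cancel_right, Real.log_one]
    ring
  · apply ContinuousOn.intervalIntegrable
    refine ContinuousOn.pow (ContinuousOn.inv₀ (by fun_prop) ?_) 1
    intro p hp
    exact (mul_pos (hpos p hp).1 (hpos p hp).2).ne'

lemma integral_pow_mul_log (n : ℕ) :
    IntegrableOn (fun t : ℝ => t ^ n * Real.log t) (Set.Ioc 0 1) ∧
    ∫ t in Set.Ioc (0:ℝ) 1, t ^ n * Real.log t = - 1 / ((n:ℝ) + 1) ^ 2 := by
  have hn : (n:ℝ) + 1 ≠ 0 := by positivity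
  have hi : IntervalIntegrable (fun t : ℝ => t ^ n * Real.log t) volume 0 1 :=
    intervalIntegral.intervalIntegrable_log'.continuousOn_mul (by fun_prop)
  refine ⟨(intervalIntegrable_iff_integrableOn_Ioc_of_le zero_le_one).1 hi, ?_⟩
  rw [← intervalIntegral.integral_of_le zero_le_one]
  have hc : Continuous (fun t : ℝ => t ^ n * (t * Real.log t) / (n + 1) - t ^ (n + 1) / (n + 1) ^ 2) := by
    have := Real.continuous_mul_log
    fun_prop
  rw [intervalIntegral.integral_eq_sub_of_hasDerivAt_of_le zero_le_one hc.continuousOn _ hi]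
  · simp; ring
  · intro t ht
    have h0 := ht.1.ne'
    have e := ((((hasDerivAt_pow n t)).mul (Real.hasDerivAt_mul_log h0)).div_const ((n:ℝ) + 1)).sub
      (((hasDerivAt_pow (n + 1) t)).div_const (((n:ℝ) + 1) ^ 2))
    refine e.congr_deriv ?_
    rcases n with _ | n
    · simp
    · simp only [Nat.add_sub_cancel]
      push_cast
      field_simp
      ring

lemma hasSum_alternating_inv_sq :
    HasSum (fun n : ℕ => (-1 : ℝ) ^ n * (- 1 / ((n:ℝ) + 1) ^ 2)) (-(Real.pi ^ 2 / 12)) := by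
  have hs : HasSum (fun n : ℕ => 1 / ((n:ℝ) + 1) ^ 2) (Real.pi ^ 2 / 6) := by
    have := (hasSum_nat_add_iff' (f := fun n : ℕ => 1 / (n:ℝ) ^ 2) 1).2 hasSum_zeta_two
    simpa using this
  have hs2 := hs.mul_left (1 / 4)
  have hodd : HasSum (fun n : ℕ => (1 + (-1 : ℝ) ^ (n + 1)) / 2 * (1 / ((n:ℝ) + 1) ^ 2))
      (1 / 4 * (Real.pi ^ 2 / 6)) := by
    have hinj : Function.Injective (fun n : ℕ => 2 * n + 1) := fun a b h => by
      simp only at h; omega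
    rw [← hinj.hasSum_iff]
    · refine Eq.mp (congrArg (fun f => HasSum f _) (funext fun n => ?_)) hs2
      simp only [Function.comp]
      have : (-1 : ℝ) ^ (2 * n + 1 + 1) = 1 := by
        rw [show 2 * n + 1 + 1 = 2 * (n + 1) by ring, pow_mul]; simp
      rw [this]
      push_cast
      have : (n:ℝ) + 1 ≠ 0 := by positivity
      rw [show (2 * (n:ℝ) + 1 + 1) = 2 * (n + 1) by ring]
      field_simp
      norm_num
    · intro x hx
      have : Even x := by
        by_contra h
        rw [Nat.not_even_iff_odd] at h
        obtain ⟨m, hm⟩ := h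
        exact hx ⟨m, hm.symm⟩
      rw [(this.add_one).neg_one_pow]
      simp
  have := (hodd.mul_left 2).sub hs
  rw [show -(Real.pi ^ 2 / 12) = 2 * (1 / 4 * (Real.pi ^ 2 / 6)) - Real.pi ^ 2 / 6 by ring]
  refine Eq.mp (congrArg (fun f => HasSum f _) (funext fun n => ?_)) this
  rw [pow_succ]
  ring

lemma integral_log_div_one_add :
    IntervalIntegrable (fun t : ℝ => Real.log t / (1 + t)) volume 0 1 ∧
    ∫ t in (0:ℝ)..1, Real.log t / (1 + t) = -(Real.pi ^ 2 / 12) := by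
  constructor
  · have : IntervalIntegrable (fun t : ℝ => Real.log t * (1 + t)⁻¹) volume 0 1 := by
      refine intervalIntegral.intervalIntegrable_log'.mul_continuousOn
        (ContinuousOn.inv₀ (by fun_prop) ?_)
      intro t ht
      rw [Set.uIcc_of_le zero_le_one] at ht
      linarith [ht.1]
    simpa [div_eq_mul_inv] using this
  rw [intervalIntegral.integral_of_le zero_le_one]
  have key := hasSum_integral_of_summable_integral_norm (μ := volume.restrict (Set.Ioc (0:ℝ) 1))
    (F := fun (n : ℕ) (t : ℝ) => (-1 : ℝ) ^ n * (t ^ n * Real.log t))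
    (fun n => (integral_pow_mul_log n).1.const_mul _) ?_
  · simp only [integral_const_mul, (integral_pow_mul_log _).2] at key
    rw [← key.unique hasSum_alternating_inv_sq]
    rw [← integral_Ioc_eq_integral_Ioo.symm, ← integral_Ioc_eq_integral_Ioo.symm]
    apply setIntegral_congr_fun measurableSet_Ioo
    intro t ht
    have : HasSum (fun n : ℕ => (-t) ^ n * Real.log t) ((1 - (-t))⁻¹ * Real.log t) :=
      (hasSum_geometric_of_abs_lt_one (by rw [abs_neg, abs_of_pos ht.1]; exact ht.2)).mul_right _
    simp only
    rw [show (fun n : ℕ => (-1 : ℝ) ^ n * (t ^ n * Real.log t)) = fun n => (-t) ^ n * Real.log t by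
      funext n; rw [neg_pow t]; ring, this.tsum_eq]
    rw [sub_neg_eq_add, div_eq_inv_mul]
  · have : ∀ n : ℕ, ∫ t in Set.Ioc (0:ℝ) 1, ‖(-1 : ℝ) ^ n * (t ^ n * Real.log t)‖
        = 1 / ((n:ℝ) + 1) ^ 2 := by
      intro n
      have h := (integral_pow_mul_log n).2
      rw [neg_div, ← neg_eq_iff_eq_neg, ← integral_neg] at h
      rw [← h]
      apply setIntegral_congr_fun measurableSet_Ioc
      intro t ht
      simp only [norm_mul, norm_pow, norm_neg, norm_one, one_pow, one_mul, Real.norm_eq_abs]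
      rw [abs_of_pos ht.1, abs_of_nonpos (Real.log_nonpos ht.1.le ht.2)]
      ring
    simp only [this]
    have := (summable_nat_add_iff 1).2 hasSum_zeta_two.summable
    simpa using this

/-- The covariance determinant of a quadrilateral-type section, with `U`, `V` the edge ratios. -/
noncomputable def secDet (U V : ℝ) : ℝ :=
  (1 / 6 - 2 / 5 * (U * V) * (U ^ 2 / 12 - U / 3 + 1 / 2))
    * (1 / 6 - 2 / 5 * (U * V) * (V ^ 2 / 12 - V / 3 + 1 / 2))
    - (1 / 12 - 2 / 5 * (U * V) * (U * V / 24 - (U + V) / 6 + 1 / 2)) ^ 2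

/-- The mean of `|p X + q Y - t Z - W|` for independent uniform variables when `p + q = 1 + t`. -/
noncomputable def meanAbs (p q t : ℝ) : ℝ :=
  1 / 4 + (p ^ 2 + q ^ 2 + t ^ 2) / 12 - t ^ 4 / (30 * (p * q))

noncomputable def lineIntegral (t : ℝ) : ℝ :=
  ((11 / 864 + 5 / 48 * t + 281 / 720 * t ^ 2 + 28817 / 32400 * t ^ 3 + 87911 / 64800 * t ^ 4
    + 2473 / 1800 * t ^ 5 + 107813 / 162000 * t ^ 6 - 43507 / 81000 * t ^ 7 - 2911 / 2000 * t ^ 8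
    - 244019 / 162000 * t ^ 9 - 148181 / 162000 * t ^ 10 - 129 / 400 * t ^ 11
    - 17803 / 324000 * t ^ 12 - 113 / 81000 * t ^ 13 - 1 / 18000 * t ^ 14 - 13 / 81000 * t ^ 15
    + 1 / 36000 * t ^ 16)
  + (2 / 45 * t + 16 / 45 * t ^ 2 + 281 / 216 * t ^ 3 + 29 / 10 * t ^ 4 + 118 / 27 * t ^ 5
    + 2113 / 450 * t ^ 6 + 826 / 225 * t ^ 7 + 1382 / 675 * t ^ 8 + 176 / 225 * t ^ 9
    + 41 / 225 * t ^ 10 + 7 / 360 * t ^ 11) * (t * Real.log t)) / (1 + t) ^ 9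

lemma secDet_meanAbs_eq {p q t : ℝ} (hp : p ≠ 0) (hq : q ≠ 0) (h : p + q = 1 + t) :
    2 * secDet (t / p) (t / q) * meanAbs p q t
      = -1 / 144 * (p * q) + (1 / 72 + 1 / 144 * t + 13 / 720 * t ^ 2) * ((p * q)⁻¹) ^ 0
        + (-1 / 45 * t ^ 2 - 2 / 135 * t ^ 3 - 1 / 48 * t ^ 4) * ((p * q)⁻¹) ^ 1
        + (1 / 135 * t ^ 3 + 1 / 45 * t ^ 4 + 17 / 1080 * t ^ 5 + 71 / 5400 * t ^ 6)
          * ((p * q)⁻¹) ^ 2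
        + (-1 / 270 * t ^ 4 - 1 / 108 * t ^ 5 - 31 / 2700 * t ^ 6 - 7 / 900 * t ^ 7
          - 49 / 10800 * t ^ 8) * ((p * q)⁻¹) ^ 3
        + (1 / 675 * t ^ 6 + 1 / 450 * t ^ 7 + 13 / 5400 * t ^ 8 + 19 / 10800 * t ^ 9
          + 43 / 54000 * t ^ 10) * ((p * q)⁻¹) ^ 4
        + (-1 / 6750 * t ^ 10 - 1 / 6750 * t ^ 11 - 1 / 18000 * t ^ 12) * ((p * q)⁻¹) ^ 5 := by
  generalize hm : (p * q)⁻¹ = m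
  generalize hn : p * q = n at *
  have hn0 : n ≠ 0 := by rw [← hn]; positivity
  have hmn : m * n = 1 := by rw [← hm]; field_simp
  have hsum : t / p + t / q = t * (1 + t) * m := by
    rw [← hm, ← h, ← hn]; field_simp; ring
  have hprod : (t / p) * (t / q) = t ^ 2 * m := by
    rw [← hm, ← hn]; field_simp
  have hsec : ∀ U V s e : ℝ, U + V = s → U * V = e → secDet U V =
      1 / 36 - 1 / 15 * e * ((s ^ 2 - 2 * e) / 12 - s / 3 + 1)
      + 4 / 25 * e ^ 2 * (e ^ 2 / 144 - e * s / 36 + (s ^ 2 - 2 * e) / 24 + e / 9 - s / 6 + 1 / 4)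
      - (1 / 12 - 2 / 5 * e * (e / 24 - s / 6 + 1 / 2)) ^ 2 := by
    rintro U V s e rfl rfl
    unfold secDet
    ring
  have hmean : meanAbs p q t = 1 / 4 + ((1 + t) ^ 2 - 2 * n + t ^ 2) / 12 - t ^ 4 * m / 30 := by
    have : p ^ 2 + q ^ 2 = (1 + t) ^ 2 - 2 * n := by rw [← h, ← hn]; ring
    rw [meanAbs, this, hn, ← hm]
    field_simp
  rw [hsec _ _ _ _ hsum hprod, hmean]
  obtain rfl : n = m⁻¹ := by rw [← hm, inv_inv]
  have : m ≠ 0 := by rintro rfl; simp at hmn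
  field_simp
  ring

lemma integral_secDet_meanAbs {t : ℝ} (ht : 0 < t) (ht1 : t ≤ 1) :
    ∫ p in t..1, 2 * secDet (t / p) (t / (1 + t - p)) * meanAbs p (1 + t - p) t
      = lineIntegral t := by
  have hpos : ∀ p ∈ Set.uIcc t 1, 0 < p ∧ 0 < 1 + t - p := by
    intro p hp
    rw [Set.uIcc_of_le ht1] at hp
    exact ⟨by linarith [hp.1], by linarith [hp.2]⟩
  have hint : ∀ (a : ℝ) (j : ℕ),
      IntervalIntegrable (fun p : ℝ => a * ((p * (1 + t - p))⁻¹) ^ j) volume t 1 := by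
    intro a j
    apply ContinuousOn.intervalIntegrable
    refine ContinuousOn.mul continuousOn_const (ContinuousOn.pow (ContinuousOn.inv₀ (by fun_prop) ?_) j)
    intro p hp
    exact (mul_pos (hpos p hp).1 (hpos p hp).2).ne'
  have hint' : ∀ a : ℝ, IntervalIntegrable (fun p : ℝ => a * (p * (1 + t - p))) volume t 1 :=
    fun a => Continuous.intervalIntegrable (by fun_prop) _ _
  rw [intervalIntegral.integral_congr (fun p hp => secDet_meanAbs_eq (hpos p hp).1.ne'
    (hpos p hp).2.ne' (by ring : p + (1 + t - p) = 1 + t))]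
  have i0 := hint' (-1 / 144)
  have i1 := i0.add (hint (1 / 72 + 1 / 144 * t + 13 / 720 * t ^ 2) 0)
  have i2 := i1.add (hint (-1 / 45 * t ^ 2 - 2 / 135 * t ^ 3 - 1 / 48 * t ^ 4) 1)
  have i3 := i2.add (hint (1 / 135 * t ^ 3 + 1 / 45 * t ^ 4 + 17 / 1080 * t ^ 5 + 71 / 5400 * t ^ 6) 2)
  have i4 := i3.add (hint (-1 / 270 * t ^ 4 - 1 / 108 * t ^ 5 - 31 / 2700 * t ^ 6 - 7 / 900 * t ^ 7
          - 49 / 10800 * t ^ 8) 3)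
  have i5 := i4.add (hint (1 / 675 * t ^ 6 + 1 / 450 * t ^ 7 + 13 / 5400 * t ^ 8 + 19 / 10800 * t ^ 9
          + 43 / 54000 * t ^ 10) 4)
  have hquad : ∫ p in t..1, p * (1 + t - p) = (1 + t) * (1 - t ^ 2) / 2 - (1 - t ^ 3) / 3 := by
    have : (fun p : ℝ => p * (1 + t - p)) = fun p => (1 + t) * p - p ^ 2 := by
      funext p; ring
    rw [this, intervalIntegral.integral_sub (Continuous.intervalIntegrable (by fun_prop) _ _)
      (Continuous.intervalIntegrable (by fun_prop) _ _), intervalIntegral.integral_const_mul,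
      integral_id, integral_pow]
    norm_num
    ring
  rw [intervalIntegral.integral_add i5 (hint _ 5), intervalIntegral.integral_add i4 (hint _ 4),
    intervalIntegral.integral_add i3 (hint _ 3), intervalIntegral.integral_add i2 (hint _ 2),
    intervalIntegral.integral_add i1 (hint _ 1), intervalIntegral.integral_add i0 (hint _ 0)]
  simp only [intervalIntegral.integral_const_mul]
  rw [integral_inv_mul_pow_succ ht ht1 (k := 4) (by norm_num),
    integral_inv_mul_pow_succ ht ht1 (k := 3) (by norm_num),
    integral_inv_mul_pow_succ ht ht1 (k := 2) (by norm_num),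
    integral_inv_mul_pow_succ ht ht1 (k := 1) (by norm_num), integral_inv_mul ht ht1, hquad]
  simp only [pow_zero, intervalIntegral.integral_const, smul_eq_mul, mul_one, lineIntegral]
  have hc : 1 + t ≠ 0 := by positivity
  generalize Real.log t = l
  push_cast
  field_simp
  ring

lemma continuousOn_lineIntegral : ContinuousOn lineIntegral (Set.Icc 0 1) := by
  have := Real.continuous_mul_log
  unfold lineIntegral
  refine ContinuousOn.div (by fun_prop) (by fun_prop) ?_
  intro t ht
  have := ht.1
  positivity

open Polynomial in
lemma integral_lineIntegral :
    ∫ t in (0:ℝ)..1, lineIntegral t = 517 / 72000 - Real.pi ^ 2 / 4320 := by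
  let A : ℝ[X] := C (67 / 4320) * X ^ 1 + C (1021 / 8640) * X ^ 2 + C (563 / 1440) * X ^ 3
    + C (47191 / 64800) * X ^ 4 + C (44033 / 54000) * X ^ 5 + C (164699 / 324000) * X ^ 6
    + C (4013 / 81000) * X ^ 7 + C (-629261 / 2592000) * X ^ 8 + C (-91583 / 324000) * X ^ 9
    + C (-116329 / 648000) * X ^ 10 + C (-7471 / 108000) * X ^ 11 + C (-8701 / 648000) * X ^ 12
    + C (-19 / 40500) * X ^ 13 + C (11 / 162000) * X ^ 14 + C (-1 / 32400) * X ^ 15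
    + C (1 / 288000) * X ^ 16
  let B : ℝ[X] := C (-1 / 360) + C (-1 / 48) * X ^ 1 + C (-19 / 360) * X ^ 2 + C (-23 / 1440) * X ^ 3
    + C (563 / 2700) * X ^ 4 + C (337 / 600) * X ^ 5 + C (2089 / 2700) * X ^ 6
    + C (14707 / 21600) * X ^ 7 + C (2201 / 5400) * X ^ 8 + C (1771 / 10800) * X ^ 9
    + C (223 / 5400) * X ^ 10 + C (7 / 1440) * X ^ 11
  let Φ : ℝ → ℝ := fun t => (A.eval t + B.eval t * (t * Real.log t)) / (1 + t) ^ 8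
  obtain ⟨hi, hlog⟩ := integral_log_div_one_add
  have hF : IntervalIntegrable lineIntegral volume 0 1 :=
    ContinuousOn.intervalIntegrable_of_Icc zero_le_one continuousOn_lineIntegral
  have hΦ : ContinuousOn Φ (Set.Icc 0 1) := by
    have := Real.continuous_mul_log
    have := A.continuous
    have := B.continuous
    refine ContinuousOn.div (by fun_prop) (by fun_prop) ?_
    intro t ht
    have := ht.1
    positivity
  have hd : ∀ t ∈ Set.Ioo (0:ℝ) 1,
      HasDerivAt Φ (lineIntegral t - 1 / 360 * (Real.log t / (1 + t))) t := by
    intro t ht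
    have h0 : t ≠ 0 := ht.1.ne'
    have hc : 1 + t ≠ 0 := by linarith [ht.1]
    have e := ((A.hasDerivAt t).add ((B.hasDerivAt t).mul (Real.hasDerivAt_mul_log h0))).div
      (((hasDerivAt_id t).const_add 1).pow 8) (pow_ne_zero 8 hc)
    refine e.congr_deriv ?_
    simp only [A, B, lineIntegral, derivative_add, derivative_C_mul_X_pow, derivative_C, eval_add,
      eval_mul, eval_C, eval_pow, eval_X, eval_zero, Pi.add_apply, Pi.mul_apply, Pi.pow_apply, id]
    generalize Real.log t = l
    push_cast
    field_simp
    ring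
  have h := intervalIntegral.integral_eq_sub_of_hasDerivAt_of_le zero_le_one hΦ hd
    (hF.sub (hi.const_mul _))
  rw [intervalIntegral.integral_sub hF (hi.const_mul _), intervalIntegral.integral_const_mul, hlog] at h
  have hv : Φ 1 - Φ 0 = 517 / 72000 := by
    simp only [Φ, A, B, eval_add, eval_mul, eval_C, eval_pow, eval_X, Real.log_one, Real.log_zero]
    norm_num
  rw [hv] at h
  linear_combination h

lemma measurePreserving_vec3 {α : Type*} [MeasurableSpace α] (μ : Measure α) [SigmaFinite μ] :
    MeasurePreserving (fun x : α × α × α => (![x.1, x.2.1, x.2.2] : Fin 3 → α))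
      (μ.prod (μ.prod μ)) (Measure.pi fun _ => μ) := by
  have hm : Measurable (fun x : α × α × α => (![x.1, x.2.1, x.2.2] : Fin 3 → α)) := by
    rw [measurable_pi_iff]
    intro i
    fin_cases i <;> simp <;> fun_prop
  refine ⟨hm, (Measure.pi_eq fun s hs => ?_).symm⟩
  have : (fun x : α × α × α => (![x.1, x.2.1, x.2.2] : Fin 3 → α)) ⁻¹' (Set.univ.pi s)
      = s 0 ×ˢ (s 1 ×ˢ s 2) := by
    ext x
    simp [Set.mem_pi, Fin.forall_fin_succ]
  rw [Measure.map_apply hm (MeasurableSet.univ_pi hs), this, Measure.prod_prod, Measure.prod_prod,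
    Fin.prod_univ_three, mul_assoc]

lemma measurePreserving_cons {α : Type*} [MeasurableSpace α] (μ : Measure α) [SigmaFinite μ]
    (n : ℕ) :
    MeasurePreserving (fun x : α × (Fin n → α) => (Fin.cons x.1 x.2 : Fin (n + 1) → α))
      (μ.prod (Measure.pi fun _ => μ)) (Measure.pi fun _ => μ) := by
  have h := (measurePreserving_piFinSuccAbove (fun _ : Fin (n + 1) => μ) 0).symm
  convert h using 1
  funext x
  simp [MeasurableEquiv.piFinSuccAbove, Fin.insertNthEquiv]

/-- The uniform distribution on the unit interval. -/
noncomputable def unif : Measure ℝ := volume.restrict (Set.Icc 0 1)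

instance : IsProbabilityMeasure unif := ⟨by simp [unif]⟩

/-- The uniform distribution on the unit cube. -/
noncomputable def unifCube (n : ℕ) : Measure (Fin n → ℝ) := Measure.pi fun _ => unif

instance (n : ℕ) : IsProbabilityMeasure (unifCube n) := by unfold unifCube; infer_instance

lemma integral_unif (f : ℝ → ℝ) : ∫ x, f x ∂unif = ∫ x in (0:ℝ)..1, f x := by
  rw [unif, integral_Icc_eq_integral_Ioc, intervalIntegral.integral_of_le zero_le_one]

lemma ae_mem_unif : ∀ᵐ x ∂unif, x ∈ Set.Icc (0:ℝ) 1 := ae_restrict_mem measurableSet_Icc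

lemma ae_mem_unifCube (n : ℕ) : ∀ᵐ y ∂unifCube n, ∀ i, y i ∈ Set.Icc (0:ℝ) 1 := by
  rw [ae_all_iff]
  intro i
  exact (measurePreserving_eval (fun _ : Fin n => unif) i).quasiMeasurePreserving.ae ae_mem_unif

lemma unif_reflect : MeasurePreserving (fun x : ℝ => 1 - x) unif unif := by
  have h := (Measure.measurePreserving_sub_left (volume : Measure ℝ) 1).restrict_preimage
    (measurableSet_Icc : MeasurableSet (Set.Icc (0:ℝ) 1))
  have e : (fun x : ℝ => 1 - x) ⁻¹' Set.Icc 0 1 = Set.Icc 0 1 := by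
    ext x; simp only [Set.mem_preimage, Set.mem_Icc]; constructor <;> rintro ⟨h, h'⟩ <;>
      constructor <;> linarith
  rw [e] at h
  exact h

lemma unifCube_reflect (n : ℕ) :
    MeasurePreserving (fun (y : Fin n → ℝ) i => 1 - y i) (unifCube n) (unifCube n) :=
  measurePreserving_pi (fun _ => unif) (fun _ => unif) fun _ => unif_reflect

/-- Measurable functions bounded on the cube are integrable. -/
lemma integrable_unifCube {n : ℕ} {f : (Fin n → ℝ) → ℝ} (hf : Measurable f) (C : ℝ)
    (h : ∀ y, (∀ i, y i ∈ Set.Icc (0:ℝ) 1) → |f y| ≤ C) : Integrable f (unifCube n) :=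
  Integrable.of_bound hf.aestronglyMeasurable C ((ae_mem_unifCube n).mono fun y hy => h y hy)

lemma integrable_unifCube_of_le {n : ℕ} {f g : (Fin n → ℝ) → ℝ} (hf : Measurable f)
    (hg : Continuous g) (h : ∀ y, |f y| ≤ |g y|) : Integrable f (unifCube n) := by
  have hK : IsCompact (Set.univ.pi fun _ : Fin n => Set.Icc (0:ℝ) 1) :=
    isCompact_univ_pi fun _ => isCompact_Icc
  obtain ⟨C, hC⟩ := hK.exists_bound_of_continuousOn hg.continuousOn
  refine integrable_unifCube hf C fun y hy => (h y).trans (hC y ?_)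
  exact fun i _ => hy i

lemma integrable_unifCube_of_continuous {n : ℕ} {g : (Fin n → ℝ) → ℝ}
    (hg : Continuous g) : Integrable g (unifCube n) :=
  integrable_unifCube_of_le hg.measurable hg fun _ => le_rfl

lemma integral_unifCube_three {f : (Fin 3 → ℝ) → ℝ} (hf : Integrable f (unifCube 3)) :
    ∫ y, f y ∂unifCube 3 = ∫ x, ∫ y, ∫ z, f ![x, y, z] ∂unif ∂unif ∂unif := by
  have hv := measurePreserving_vec3 unif
  have hfm : AEStronglyMeasurable f (Measure.map (fun x : ℝ × ℝ × ℝ => ![x.1, x.2.1, x.2.2])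
      (unif.prod (unif.prod unif))) := by
    rw [hv.map_eq]; exact hf.aestronglyMeasurable
  have h1 : ∫ y, f y ∂unifCube 3
      = ∫ x, f ![x.1, x.2.1, x.2.2] ∂(unif.prod (unif.prod unif)) := by
    rw [unifCube, ← hv.map_eq, integral_map hv.measurable.aemeasurable hfm]
  have h2 : Integrable (fun x : ℝ × ℝ × ℝ => f ![x.1, x.2.1, x.2.2])
      (unif.prod (unif.prod unif)) :=
    (hv.integrable_comp hf.aestronglyMeasurable).2 hf
  rw [h1, integral_prod _ h2]
  refine integral_congr_ae (h2.prod_right_ae.mono fun x hx => ?_)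
  simp only
  rw [integral_prod _ hx]

lemma integral_unif_ite_lt {c : ℝ} (h0 : 0 ≤ c) (h1 : c ≤ 1) (g : ℝ → ℝ) :
    ∫ x, (if x < c then g x else 0) ∂unif = ∫ x in (0:ℝ)..c, g x := by
  have : (fun x => if x < c then g x else 0) = Set.indicator (Set.Iio c) g := by
    funext x; simp [Set.indicator]
  rw [this, integral_indicator measurableSet_Iio, unif, Measure.restrict_restrict measurableSet_Iio,
    intervalIntegral.integral_of_le h0, integral_Ioc_eq_integral_Ioo, ← integral_Ico_eq_integral_Ioo]
  congr 2
  ext x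
  simp only [Set.mem_inter_iff, Set.mem_Iio, Set.mem_Icc, Set.mem_Ico]
  constructor
  · rintro ⟨h, h', h''⟩; exact ⟨h', h⟩
  · rintro ⟨h, h'⟩; exact ⟨h', h, by linarith⟩

lemma integral_of_eq_poly {f : ℝ → ℝ} (a₀ a₁ a₂ a₃ a₄ : ℝ)
    (h : ∀ x, f x = a₀ + a₁ * x + a₂ * x ^ 2 + a₃ * x ^ 3 + a₄ * x ^ 4) (c : ℝ) :
    ∫ x in (0:ℝ)..c, f x
      = a₀ * c + a₁ * c ^ 2 / 2 + a₂ * c ^ 3 / 3 + a₃ * c ^ 4 / 4 + a₄ * c ^ 5 / 5 := by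
  have hd : ∀ x ∈ Set.uIcc 0 c, HasDerivAt
      (fun c => a₀ * c + a₁ * c ^ 2 / 2 + a₂ * c ^ 3 / 3 + a₃ * c ^ 4 / 4 + a₄ * c ^ 5 / 5)
      (f x) x := by
    intro x _
    have e := (((((hasDerivAt_id x).const_mul a₀).add
      (((hasDerivAt_pow 2 x).const_mul a₁).div_const 2)).add
      (((hasDerivAt_pow 3 x).const_mul a₂).div_const 3)).add
      (((hasDerivAt_pow 4 x).const_mul a₃).div_const 4)).add
      (((hasDerivAt_pow 5 x).const_mul a₄).div_const 5)
    refine e.congr_deriv ?_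
    rw [h]
    norm_num
    ring
  rw [intervalIntegral.integral_eq_sub_of_hasDerivAt hd]
  · ring
  · rw [funext h]
    exact Continuous.intervalIntegrable (by fun_prop) _ _

lemma integral_quadratic (α β γ δ ε ζ a b c d : ℝ) :
    ∫ y, (α * y 0 ^ 2 + β * y 1 ^ 2 + γ * y 2 ^ 2 + δ * (y 0 * y 1) + ε * (y 0 * y 2)
      + ζ * (y 1 * y 2) + a * y 0 + b * y 1 + c * y 2 + d) ∂unifCube 3
      = (α + β + γ) / 3 + (δ + ε + ζ) / 4 + (a + b + c) / 2 + d := by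
  rw [integral_unifCube_three (integrable_unifCube_of_continuous (by fun_prop))]
  simp only [integral_unif, Matrix.cons_val_zero, Matrix.cons_val_one, Matrix.cons_val]
  have h1 : ∀ x y : ℝ, ∫ z in (0:ℝ)..1, (α * x ^ 2 + β * y ^ 2 + γ * z ^ 2 + δ * (x * y)
      + ε * (x * z) + ζ * (y * z) + a * x + b * y + c * z + d) =
      (α * x ^ 2 + β * y ^ 2 + δ * (x * y) + a * x + b * y + d) + (ε * x + ζ * y + c) / 2 + γ / 3 := by
    intro x y
    rw [integral_of_eq_poly (α * x ^ 2 + β * y ^ 2 + δ * (x * y) + a * x + b * y + d)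
      (ε * x + ζ * y + c) γ 0 0 (fun z => by ring)]
    ring
  simp only [h1]
  have h2 : ∀ x : ℝ, ∫ y in (0:ℝ)..1, ((α * x ^ 2 + β * y ^ 2 + δ * (x * y) + a * x + b * y + d)
      + (ε * x + ζ * y + c) / 2 + γ / 3) =
      α * x ^ 2 + a * x + d + (ε * x + c) / 2 + γ / 3 + (δ * x + b + ζ / 2) / 2 + β / 3 := by
    intro x
    rw [integral_of_eq_poly (α * x ^ 2 + a * x + d + (ε * x + c) / 2 + γ / 3)
      (δ * x + b + ζ / 2) β 0 0 (fun z => by ring)]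
    ring
  simp only [h2]
  rw [integral_of_eq_poly (d + c / 2 + γ / 3 + (b + ζ / 2) / 2 + β / 3)
      (a + ε / 2 + δ / 2) α 0 0 (fun z => by ring)]
  ring

lemma measurableSet_corner (p q t : ℝ) :
    MeasurableSet {y : Fin 3 → ℝ | p * y 1 + q * y 2 < t * y 0} :=
  measurableSet_lt (by fun_prop) (by fun_prop)

lemma integral_quadratic_corner {p q t : ℝ} (hp : 0 < p) (hq : 0 < q) (ht : 0 ≤ t) (htp : t ≤ p)
    (htq : t ≤ q) (α β γ δ ε ζ : ℝ) :
    ∫ y, (if p * y 1 + q * y 2 < t * y 0 then α * y 0 ^ 2 + β * y 1 ^ 2 + γ * y 2 ^ 2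
      + δ * (y 0 * y 1) + ε * (y 0 * y 2) + ζ * (y 1 * y 2) else 0) ∂unifCube 3
      = t ^ 2 / (5 * (p * q)) * (α / 2 + β * t ^ 2 / (12 * p ^ 2) + γ * t ^ 2 / (12 * q ^ 2)
        + δ * t / (6 * p) + ε * t / (6 * q) + ζ * t ^ 2 / (24 * (p * q))) := by
  have hint : Integrable (fun y : Fin 3 → ℝ =>
      if p * y 1 + q * y 2 < t * y 0 then α * y 0 ^ 2 + β * y 1 ^ 2 + γ * y 2 ^ 2
      + δ * (y 0 * y 1) + ε * (y 0 * y 2) + ζ * (y 1 * y 2) else 0) (unifCube 3) := by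
    refine integrable_unifCube_of_le (g := fun y => α * y 0 ^ 2 + β * y 1 ^ 2 + γ * y 2 ^ 2
      + δ * (y 0 * y 1) + ε * (y 0 * y 2) + ζ * (y 1 * y 2))
      (Measurable.ite (measurableSet_corner p q t) (by fun_prop) measurable_const) (by fun_prop) ?_
    intro y
    split_ifs
    · exact le_rfl
    · simp
  rw [integral_unifCube_three hint]
  change ∫ x, ∫ y, ∫ z, (if p * y + q * z < t * x then α * x ^ 2 + β * y ^ 2 + γ * z ^ 2
    + δ * (x * y) + ε * (x * z) + ζ * (y * z) else 0) ∂unif ∂unif ∂unif = _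
  have hp0 := hp.ne'
  have hq0 := hq.ne'
  have hz : ∀ x ∈ Set.Icc (0:ℝ) 1, ∀ y ∈ Set.Icc (0:ℝ) 1,
      ∫ z, (if p * y + q * z < t * x then α * x ^ 2 + β * y ^ 2 + γ * z ^ 2
      + δ * (x * y) + ε * (x * z) + ζ * (y * z) else 0) ∂unif
      = if y < t * x / p then (α * x ^ 2 + β * y ^ 2 + δ * (x * y)) * ((t * x - p * y) / q)
        + (ε * x + ζ * y) * ((t * x - p * y) / q) ^ 2 / 2
        + γ * ((t * x - p * y) / q) ^ 3 / 3 else 0 := by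
    intro x hx y hy
    have hiff : ∀ z, (p * y + q * z < t * x) ↔ z < (t * x - p * y) / q := by
      intro z
      rw [lt_div_iff₀ hq]
      constructor <;> intro h <;> linarith
    simp only [hiff]
    split_ifs with h
    · rw [lt_div_iff₀ hp] at h
      rw [integral_unif_ite_lt (by apply div_nonneg <;> linarith)
        (by rw [div_le_one hq]; nlinarith [hx.1, hx.2, hy.1, hy.2]),
        integral_of_eq_poly (α * x ^ 2 + β * y ^ 2 + δ * (x * y)) (ε * x + ζ * y) γ 0 0
          (fun z => by ring)]
      ring
    · rw [lt_div_iff₀ hp, not_lt] at h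
      rw [integral_eq_zero_of_ae]
      filter_upwards [ae_mem_unif] with z hzz
      rw [if_neg]
      · rfl
      · rw [lt_div_iff₀ hq]
        nlinarith [hzz.1]
  have hy : ∀ x ∈ Set.Icc (0:ℝ) 1,
      ∫ y, ∫ z, (if p * y + q * z < t * x then α * x ^ 2 + β * y ^ 2 + γ * z ^ 2
      + δ * (x * y) + ε * (x * z) + ζ * (y * z) else 0) ∂unif ∂unif
      = t ^ 2 / (p * q) * (α / 2 + β * t ^ 2 / (12 * p ^ 2) + γ * t ^ 2 / (12 * q ^ 2)
        + δ * t / (6 * p) + ε * t / (6 * q) + ζ * t ^ 2 / (24 * (p * q))) * x ^ 4 := by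
    intro x hx
    rw [integral_congr_ae (ae_mem_unif.mono fun y hy => hz x hx y hy)]
    rw [integral_unif_ite_lt (div_nonneg (mul_nonneg ht hx.1) hp.le)
        (by rw [div_le_one hp]; nlinarith [hx.1, hx.2])
        (fun y => (α * x ^ 2 + β * y ^ 2 + δ * (x * y)) * ((t * x - p * y) / q)
        + (ε * x + ζ * y) * ((t * x - p * y) / q) ^ 2 / 2
        + γ * ((t * x - p * y) / q) ^ 3 / 3)]
    rw [integral_of_eq_poly
      (α * x ^ 2 * (t * x / q) + ε * x * (t * x / q) ^ 2 / 2 + γ * (t * x / q) ^ 3 / 3)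
      (- α * x ^ 2 * (p / q) + δ * x * (t * x / q) + ζ * (t * x / q) ^ 2 / 2
        - ε * x * (t * x / q) * (p / q) - γ * (t * x / q) ^ 2 * (p / q))
      (β * (t * x / q) - δ * x * (p / q) + ε * x * (p / q) ^ 2 / 2 - ζ * (t * x / q) * (p / q)
        + γ * (t * x / q) * (p / q) ^ 2)
      (- β * (p / q) + ζ * (p / q) ^ 2 / 2 - γ * (p / q) ^ 3 / 3) 0
      (fun y => by field_simp; ring)]
    field_simp
    ring
  rw [integral_congr_ae (ae_mem_unif.mono fun x hx => hy x hx), integral_unif,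
    integral_of_eq_poly 0 0 0 0 (t ^ 2 / (p * q) * (α / 2 + β * t ^ 2 / (12 * p ^ 2)
      + γ * t ^ 2 / (12 * q ^ 2)
        + δ * t / (6 * p) + ε * t / (6 * q) + ζ * t ^ 2 / (24 * (p * q)))) (fun x => by ring)]
  field_simp
  ring

/-- The points whose affine combination with weights `1 - p - q, p, q` lies in `[0, 1]`. -/
def slab (p q : ℝ) : Set (Fin 3 → ℝ) :=
  {y | (1 - p - q) * y 0 + p * y 1 + q * y 2 ∈ Set.Icc (0:ℝ) 1}

lemma measurableSet_slab (p q : ℝ) : MeasurableSet (slab p q) :=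
  measurableSet_Icc.preimage (f := fun y : Fin 3 → ℝ => (1 - p - q) * y 0 + p * y 1 + q * y 2)
    (by fun_prop)

/-- The mean of `|∑ i, a i * X i|` for independent uniform variables. -/
noncomputable def meanLin (a : Fin 4 → ℝ) : ENNReal :=
  ∫⁻ x, ENNReal.ofReal |∑ i, a i * x i| ∂unifCube 4

/-- The squared area of a projected random triangle, restricted to those triangles for which
the point with barycentric coordinates `1 - p - q, p, q` lies in the unit square. -/
noncomputable def secMass (p q : ℝ) : ENNReal :=
  ∫⁻ y in slab p q, ∫⁻ z in slab p q,
    ENNReal.ofReal (((y 1 - y 0) * (z 2 - z 0) - (y 2 - y 0) * (z 1 - z 0)) ^ 2)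
      ∂unifCube 3 ∂unifCube 3

lemma integral_linear_combination {α : Type*} [MeasurableSpace α] {μ : Measure α} {f g h : α → ℝ}
    (hf : Integrable f μ) (hg : Integrable g μ) (hh : Integrable h μ) (a b c : ℝ) :
    ∫ x, (a * f x + b * g x + c * h x) ∂μ
      = a * ∫ x, f x ∂μ + b * ∫ x, g x ∂μ + c * ∫ x, h x ∂μ := by
  have h1 : Integrable (fun x => a * f x + b * g x) μ := (hf.const_mul a).add (hg.const_mul b)
  rw [integral_add h1 (hh.const_mul c), integral_add (hf.const_mul a) (hg.const_mul b),
    integral_const_mul, integral_const_mul, integral_const_mul]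

lemma exists_secMass_eq (p q : ℝ) :
    ∃ d, 0 ≤ d ∧ secMass p q = ENNReal.ofReal d ∧
      d = 2 * ((∫ y in slab p q, (y 1 - y 0) ^ 2 ∂unifCube 3)
      * (∫ y in slab p q, (y 2 - y 0) ^ 2 ∂unifCube 3)
      - (∫ y in slab p q, (y 1 - y 0) * (y 2 - y 0) ∂unifCube 3) ^ 2) := by
  set A := ∫ y in slab p q, (y 1 - y 0) ^ 2 ∂unifCube 3
  set B := ∫ y in slab p q, (y 2 - y 0) ^ 2 ∂unifCube 3
  set C := ∫ y in slab p q, (y 1 - y 0) * (y 2 - y 0) ∂unifCube 3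
  have key : ∀ a b : ℝ, Integrable (fun z : Fin 3 → ℝ => (a * (z 2 - z 0) - b * (z 1 - z 0)) ^ 2)
      ((unifCube 3).restrict (slab p q)) ∧
      ∫ z in slab p q, (a * (z 2 - z 0) - b * (z 1 - z 0)) ^ 2 ∂unifCube 3
        = a ^ 2 * B - 2 * a * b * C + b ^ 2 * A := by
    intro a b
    have i1 : Integrable (fun y : Fin 3 → ℝ => (y 1 - y 0) ^ 2)
      ((unifCube 3).restrict (slab p q)) :=
      (integrable_unifCube_of_continuous (by fun_prop)).restrict
    have i2 : Integrable (fun y : Fin 3 → ℝ => (y 2 - y 0) ^ 2)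
      ((unifCube 3).restrict (slab p q)) :=
      (integrable_unifCube_of_continuous (by fun_prop)).restrict
    have i3 : Integrable (fun y : Fin 3 → ℝ => (y 1 - y 0) * (y 2 - y 0))
      ((unifCube 3).restrict (slab p q)) :=
      (integrable_unifCube_of_continuous (by fun_prop)).restrict
    refine ⟨(integrable_unifCube_of_continuous (by fun_prop)).restrict, ?_⟩
    have e : ∀ z : Fin 3 → ℝ, (a * (z 2 - z 0) - b * (z 1 - z 0)) ^ 2
      = a ^ 2 * (z 2 - z 0) ^ 2 + (-2 * a * b) * ((z 1 - z 0) * (z 2 - z 0))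
        + b ^ 2 * (z 1 - z 0) ^ 2 := fun z => by ring
    simp only [e]
    rw [integral_linear_combination i2 i3 i1]
    change a ^ 2 * B + (-2 * a * b) * C + b ^ 2 * A = _
    ring
  have h1 : ∀ y : Fin 3 → ℝ, ∫⁻ z in slab p q,
      ENNReal.ofReal (((y 1 - y 0) * (z 2 - z 0) - (y 2 - y 0) * (z 1 - z 0)) ^ 2) ∂unifCube 3
      = ENNReal.ofReal ((y 1 - y 0) ^ 2 * B - 2 * (y 1 - y 0) * (y 2 - y 0) * C
        + (y 2 - y 0) ^ 2 * A) := by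
    intro y
    obtain ⟨hi, he⟩ := key (y 1 - y 0) (y 2 - y 0)
    rw [← he, ofReal_integral_eq_lintegral_ofReal hi (ae_of_all _ fun z => sq_nonneg _)]
  have h0 : ∀ y : Fin 3 → ℝ, 0 ≤ (y 1 - y 0) ^ 2 * B - 2 * (y 1 - y 0) * (y 2 - y 0) * C
        + (y 2 - y 0) ^ 2 * A := by
    intro y
    rw [← (key (y 1 - y 0) (y 2 - y 0)).2]
    exact integral_nonneg fun z => sq_nonneg _
  rw [secMass]
  simp only [h1]
  rw [← ofReal_integral_eq_lintegral_ofReal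
    (integrable_unifCube_of_continuous (by fun_prop)).restrict (ae_of_all _ h0)]
  refine ⟨_, integral_nonneg h0, rfl, ?_⟩
  have i1 : Integrable (fun y : Fin 3 → ℝ => (y 1 - y 0) ^ 2)
    ((unifCube 3).restrict (slab p q)) :=
    (integrable_unifCube_of_continuous (by fun_prop)).restrict
  have i2 : Integrable (fun y : Fin 3 → ℝ => (y 2 - y 0) ^ 2)
    ((unifCube 3).restrict (slab p q)) :=
    (integrable_unifCube_of_continuous (by fun_prop)).restrict
  have i3 : Integrable (fun y : Fin 3 → ℝ => (y 1 - y 0) * (y 2 - y 0))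
    ((unifCube 3).restrict (slab p q)) :=
    (integrable_unifCube_of_continuous (by fun_prop)).restrict
  have e : ∀ y : Fin 3 → ℝ, (y 1 - y 0) ^ 2 * B - 2 * (y 1 - y 0) * (y 2 - y 0) * C
        + (y 2 - y 0) ^ 2 * A = B * (y 1 - y 0) ^ 2 + (-2 * C) * ((y 1 - y 0) * (y 2 - y 0))
        + A * (y 2 - y 0) ^ 2 := fun y => by ring
  simp only [e]
  rw [integral_linear_combination i1 i3 i2]
  change B * A + (-2 * C) * C + A * B = _
  ring

lemma mem_slab_of_nonneg {p q : ℝ} (hp : 0 ≤ p) (hq : 0 ≤ q) (hpq : p + q ≤ 1) {y : Fin 3 → ℝ}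
    (hy : ∀ i, y i ∈ Set.Icc (0:ℝ) 1) : y ∈ slab p q := by
  have hr : 0 ≤ 1 - p - q := by linarith
  constructor
  · have := mul_nonneg hr (hy 0).1
    have := mul_nonneg hp (hy 1).1
    have := mul_nonneg hq (hy 2).1
    linarith
  · have := mul_le_mul_of_nonneg_left (hy 0).2 hr
    have := mul_le_mul_of_nonneg_left (hy 1).2 hp
    have := mul_le_mul_of_nonneg_left (hy 2).2 hq
    linarith

lemma secMass_of_nonneg {p q : ℝ} (hp : 0 ≤ p) (hq : 0 ≤ q) (hpq : p + q ≤ 1) :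
    secMass p q = ENNReal.ofReal (1 / 24) := by
  have hr : (unifCube 3).restrict (slab p q) = unifCube 3 :=
    Measure.restrict_eq_self_of_ae_mem
      ((ae_mem_unifCube 3).mono fun y hy => mem_slab_of_nonneg hp hq hpq hy)
  have h1 := integral_quadratic 1 1 0 (-2) 0 0 0 0 0 0
  have h2 := integral_quadratic 1 0 1 0 (-2) 0 0 0 0 0
  have h3 := integral_quadratic 1 0 0 (-1) (-1) 1 0 0 0 0
  have e1 : ∫ y, (y 1 - y 0) ^ 2 ∂unifCube 3 = 1 / 6 := by
    rw [← show _ = (1 / 6 : ℝ) from h1.trans (by norm_num)]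
    congr 1; funext y; ring
  have e2 : ∫ y, (y 2 - y 0) ^ 2 ∂unifCube 3 = 1 / 6 := by
    rw [← show _ = (1 / 6 : ℝ) from h2.trans (by norm_num)]
    congr 1; funext y; ring
  have e3 : ∫ y, (y 1 - y 0) * (y 2 - y 0) ∂unifCube 3 = 1 / 12 := by
    rw [← show _ = (1 / 12 : ℝ) from h3.trans (by norm_num)]
    congr 1; funext y; ring
  obtain ⟨d, -, hd, rfl⟩ := exists_secMass_eq p q
  rw [hd, hr, e1, e2, e3]
  norm_num

/-- The part of a reflection invariant integral lying outside the slab comes in two equal halves. -/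
lemma setIntegral_slab {p q t : ℝ} (h : p + q = 1 + t) {g : (Fin 3 → ℝ) → ℝ} (hg : Continuous g)
    (hs : ∀ y, g (fun i => 1 - y i) = g y) :
    ∫ y in slab p q, g y ∂unifCube 3 = ∫ y, g y ∂unifCube 3
      - 2 * ∫ y, (if p * y 1 + q * y 2 < t * y 0 then g y else 0) ∂unifCube 3 := by
  have hgi := integrable_unifCube_of_continuous hg
  have hi : Integrable (fun y => if p * y 1 + q * y 2 < t * y 0 then g y else 0) (unifCube 3) := by
    refine integrable_unifCube_of_le (Measurable.ite (measurableSet_corner p q t) hg.measurable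
      measurable_const) hg fun y => ?_
    split_ifs <;> simp
  have hR := unifCube_reflect 3
  have hi' := hR.integrable_comp_of_integrable hi
  have e' : ∫ y, (if p * y 1 + q * y 2 < t * y 0 then g y else 0) ∂unifCube 3
      = ∫ y : Fin 3 → ℝ, (if p * (1 - y 1) + q * (1 - y 2) < t * (1 - y 0) then g y else 0)
        ∂unifCube 3 := by
    have := integral_map (μ := unifCube 3) hR.measurable.aemeasurable (f := fun y : Fin 3 → ℝ =>
      if p * y 1 + q * y 2 < t * y 0 then g y else 0) (by rw [hR.map_eq]; exact hi.1)
    rw [hR.map_eq] at this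
    rw [this]
    simp only [hs]
  have hj : Integrable (fun y : Fin 3 → ℝ =>
      if p * (1 - y 1) + q * (1 - y 2) < t * (1 - y 0) then g y else 0) (unifCube 3) := by
    refine hi'.congr (ae_of_all _ fun y => ?_)
    simp only [Function.comp, hs]
  have hc := integral_linear_combination hgi hi hj 1 (-1) (-1)
  rw [← e'] at hc
  rw [← integral_indicator (measurableSet_slab p q), show ∀ a b : ℝ, a - 2 * b
    = 1 * a + -1 * b + -1 * b from fun a b => by ring, ← hc]
  · refine integral_congr_ae (ae_of_all _ fun y => ?_)
    have hr : 1 - p - q = -t := by linarith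
    simp only [Set.indicator, slab, Set.mem_ofPred_eq, Set.mem_Icc, hr]
    by_cases h1 : p * y 1 + q * y 2 < t * y 0
    · have h2 : ¬ (p * (1 - y 1) + q * (1 - y 2) < t * (1 - y 0)) := by linarith
      rw [if_pos h1, if_neg h2, if_neg (by intro h; linarith [h.1])]
      ring
    · by_cases h2 : p * (1 - y 1) + q * (1 - y 2) < t * (1 - y 0)
      · rw [if_neg h1, if_pos h2, if_neg (by intro h; linarith [h.2])]
        ring
      · rw [if_neg h1, if_neg h2, if_pos (by constructor <;> linarith)]
        ring

lemma integral_quadratic' (α β γ δ ε ζ : ℝ) :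
    ∫ y, (α * y 0 ^ 2 + β * y 1 ^ 2 + γ * y 2 ^ 2 + δ * (y 0 * y 1) + ε * (y 0 * y 2)
      + ζ * (y 1 * y 2)) ∂unifCube 3 = (α + β + γ) / 3 + (δ + ε + ζ) / 4 := by
  simpa using integral_quadratic α β γ δ ε ζ 0 0 0 0

lemma secMass_of_one_le {p q t : ℝ} (hp : 0 < p) (hq : 0 < q) (ht : 0 ≤ t) (htp : t ≤ p)
    (htq : t ≤ q) (h : p + q = 1 + t) :
    0 ≤ 2 * secDet (t / p) (t / q) ∧
      secMass p q = ENNReal.ofReal (2 * secDet (t / p) (t / q)) := by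
  have hp0 := hp.ne'
  have hq0 := hq.ne'
  have k1 := integral_quadratic_corner hp hq ht htp htq 1 1 0 (-2) 0 0
  have m1 := integral_quadratic' 1 1 0 (-2) 0 0
  have k2 := integral_quadratic_corner hp hq ht htp htq 1 0 1 0 (-2) 0
  have m2 := integral_quadratic' 1 0 1 0 (-2) 0
  have k3 := integral_quadratic_corner hp hq ht htp htq 1 0 0 (-1) (-1) 1
  have m3 := integral_quadratic' 1 0 0 (-1) (-1) 1
  have e1 : ∫ y in slab p q, (y 1 - y 0) ^ 2 ∂unifCube 3 =
      1 / 6 - 2 / 5 * (t / p * (t / q)) * ((t / p) ^ 2 / 12 - t / p / 3 + 1 / 2) := by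
    rw [setIntegral_slab h (by fun_prop) (fun y => by ring)]
    have a : ∀ y : Fin 3 → ℝ, (y 1 - y 0) ^ 2 = 1 * y 0 ^ 2 + 1 * y 1 ^ 2 + 0 * y 2 ^ 2
      + -2 * (y 0 * y 1) + 0 * (y 0 * y 2) + 0 * (y 1 * y 2) := fun y => by ring
    simp only [a]
    rw [k1, m1]
    field_simp
    ring
  have e2 : ∫ y in slab p q, (y 2 - y 0) ^ 2 ∂unifCube 3 =
      1 / 6 - 2 / 5 * (t / p * (t / q)) * ((t / q) ^ 2 / 12 - t / q / 3 + 1 / 2) := by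
    rw [setIntegral_slab h (by fun_prop) (fun y => by ring)]
    have a : ∀ y : Fin 3 → ℝ, (y 2 - y 0) ^ 2 = 1 * y 0 ^ 2 + 0 * y 1 ^ 2 + 1 * y 2 ^ 2
      + 0 * (y 0 * y 1) + -2 * (y 0 * y 2) + 0 * (y 1 * y 2) := fun y => by ring
    simp only [a]
    rw [k2, m2]
    field_simp
    ring
  have e3 : ∫ y in slab p q, (y 1 - y 0) * (y 2 - y 0) ∂unifCube 3 =
      1 / 12 - 2 / 5 * (t / p * (t / q)) * (t / p * (t / q) / 24 - (t / p + t / q) / 6 + 1 / 2) := by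
    rw [setIntegral_slab h (by fun_prop) (fun y => by ring)]
    have a : ∀ y : Fin 3 → ℝ, (y 1 - y 0) * (y 2 - y 0) = 1 * y 0 ^ 2 + 0 * y 1 ^ 2 + 0 * y 2 ^ 2
      + -1 * (y 0 * y 1) + -1 * (y 0 * y 2) + 1 * (y 1 * y 2) := fun y => by ring
    simp only [a]
    rw [k3, m3]
    field_simp
    ring
  obtain ⟨d, h0, hd, e⟩ := exists_secMass_eq p q
  rw [e1, e2, e3] at e
  rw [secDet, ← e]
  exact ⟨h0, hd⟩

lemma integral_abs_sub_unif (s : ℝ) :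
    ∫ x, |s - x| ∂unif = s ^ 2 - s + 1 / 2 - (if s < 0 then s ^ 2 else 0)
      - (if 1 - s < 0 then (1 - s) ^ 2 else 0) := by
  have hc : ∀ a b : ℝ, IntervalIntegrable (fun x => |s - x|) volume a b := fun a b =>
    Continuous.intervalIntegrable (by fun_prop) _ _
  have hneg : ∀ a b : ℝ, ∫ x in a..b, (x - s) = (b ^ 2 - a ^ 2) / 2 - s * (b - a) := by
    intro a b
    rw [intervalIntegral.integral_sub (by simp) (by simp)]
    simp; ring
  have hpos : ∀ a b : ℝ, ∫ x in a..b, (s - x) = s * (b - a) - (b ^ 2 - a ^ 2) / 2 := by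
    intro a b
    rw [intervalIntegral.integral_sub (by simp) (by simp)]
    simp; ring
  have c1 : ∀ {a b : ℝ}, a ≤ b → s ≤ a → ∫ x in a..b, |s - x|
      = (b ^ 2 - a ^ 2) / 2 - s * (b - a) := by
    intro a b hab hs
    rw [← hneg]
    refine intervalIntegral.integral_congr fun x hx => ?_
    rw [Set.uIcc_of_le hab] at hx
    rw [abs_of_nonpos (by linarith [hx.1])]
    ring
  have c2 : ∀ {a b : ℝ}, a ≤ b → b ≤ s → ∫ x in a..b, |s - x|
      = s * (b - a) - (b ^ 2 - a ^ 2) / 2 := by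
    intro a b hab hs
    rw [← hpos]
    refine intervalIntegral.integral_congr fun x hx => ?_
    rw [Set.uIcc_of_le hab] at hx
    rw [abs_of_nonneg (by linarith [hx.2])]
  rw [integral_unif]
  by_cases h0 : s < 0
  · rw [if_pos h0, if_neg (by linarith), c1 zero_le_one h0.le]; ring
  by_cases h1 : 1 - s < 0
  · rw [if_neg h0, if_pos h1, c2 zero_le_one (by linarith)]; ring
  rw [if_neg h0, if_neg h1, ← intervalIntegral.integral_add_adjacent_intervals (hc 0 s) (hc s 1),
    c2 (not_lt.1 h0) le_rfl, c1 (by linarith) le_rfl]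
  ring

lemma meanLin_eq (r p q : ℝ) :
    meanLin ![-1, r, p, q] = ENNReal.ofReal (∫ y, ((r * y 0 + p * y 1 + q * y 2) ^ 2
      - (r * y 0 + p * y 1 + q * y 2) + 1 / 2
      - (if r * y 0 + p * y 1 + q * y 2 < 0 then (r * y 0 + p * y 1 + q * y 2) ^ 2 else 0)
      - (if 1 - (r * y 0 + p * y 1 + q * y 2) < 0
          then (1 - (r * y 0 + p * y 1 + q * y 2)) ^ 2 else 0)) ∂unifCube 3) := by
  have hi : Integrable (fun x : Fin 4 → ℝ => |∑ i, (![-1, r, p, q] : Fin 4 → ℝ) i * x i|)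
    (unifCube 4) := integrable_unifCube_of_continuous (by fun_prop)
  rw [meanLin, ← ofReal_integral_eq_lintegral_ofReal hi (ae_of_all _ fun x => abs_nonneg _)]
  congr 1
  have hm := measurePreserving_cons unif 3
  have hi2 := (hm.integrable_comp hi.aestronglyMeasurable).2 hi
  rw [unifCube, ← hm.map_eq, integral_map hm.measurable.aemeasurable
    (by rw [hm.map_eq]; exact hi.1)]
  refine (integral_prod_symm _ hi2).trans ?_
  congr 1
  funext y
  rw [← integral_abs_sub_unif]
  congr 1
  funext x
  rw [Function.comp, Fin.sum_univ_four]
  congr 1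
  change -1 * x + r * y 0 + p * y 1 + q * y 2 = _
  ring

lemma meanLin_of_nonneg {r p q : ℝ} (hr : 0 ≤ r) (hp : 0 ≤ p) (hq : 0 ≤ q) (h : r + p + q = 1) :
    meanLin ![-1, r, p, q] = ENNReal.ofReal (1 / 4 + (p ^ 2 + q ^ 2 + r ^ 2) / 12) := by
  rw [meanLin_eq]
  congr 1
  have k := integral_quadratic (r ^ 2) (p ^ 2) (q ^ 2) (2 * (r * p)) (2 * (r * q)) (2 * (p * q))
    (-r) (-p) (-q) (1 / 2)
  trans (r ^ 2 + p ^ 2 + q ^ 2) / 3 + (2 * (r * p) + 2 * (r * q) + 2 * (p * q)) / 4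
    + (-r + -p + -q) / 2 + 1 / 2
  · rw [← k]
    refine integral_congr_ae ((ae_mem_unifCube 3).mono fun y hy => ?_)
    have hs := mem_slab_of_nonneg hp hq (by linarith) hy
    rw [slab, Set.mem_ofPred_eq, show 1 - p - q = r by linarith] at hs
    simp only
    rw [if_neg (not_lt.2 hs.1), if_neg (by linarith [hs.2])]
    ring
  · rw [show r = 1 - p - q by linarith]
    ring

lemma meanLin_of_one_le {p q t : ℝ} (hp : 0 < p) (hq : 0 < q) (ht : 0 ≤ t) (htp : t ≤ p)
    (htq : t ≤ q) (h : p + q = 1 + t) :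
    meanLin ![-1, 1 - p - q, p, q] = ENNReal.ofReal (meanAbs p q t) := by
  rw [meanLin_eq]
  congr 1
  have hr : 1 - p - q = -t := by linarith
  simp only [hr]
  have k := integral_quadratic (t ^ 2) (p ^ 2) (q ^ 2) (-2 * (t * p)) (-2 * (t * q)) (2 * (p * q))
    t (-p) (-q) (1 / 2)
  have k2 := integral_quadratic_corner hp hq ht htp htq (t ^ 2) (p ^ 2) (q ^ 2) (-2 * (t * p))
    (-2 * (t * q)) (2 * (p * q))
  have hi : Integrable (fun y : Fin 3 → ℝ => if p * y 1 + q * y 2 < t * y 0 then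
      (-t * y 0 + p * y 1 + q * y 2) ^ 2 else 0) (unifCube 3) := by
    refine integrable_unifCube_of_le (g := fun y => (-t * y 0 + p * y 1 + q * y 2) ^ 2)
      (Measurable.ite (measurableSet_corner p q t) (by fun_prop) measurable_const)
      (by fun_prop) fun y => ?_
    split_ifs
    · exact le_rfl
    · rw [abs_zero]; exact abs_nonneg _
  have hR := unifCube_reflect 3
  have hi' := hR.integrable_comp_of_integrable hi
  have e' : ∫ y, (if p * y 1 + q * y 2 < t * y 0 then
      (-t * y 0 + p * y 1 + q * y 2) ^ 2 else 0) ∂unifCube 3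
      = ∫ y : Fin 3 → ℝ, (if p * (1 - y 1) + q * (1 - y 2) < t * (1 - y 0) then
      (-t * (1 - y 0) + p * (1 - y 1) + q * (1 - y 2)) ^ 2 else 0) ∂unifCube 3 := by
    have := integral_map (μ := unifCube 3) hR.measurable.aemeasurable (f := fun y : Fin 3 → ℝ =>
      if p * y 1 + q * y 2 < t * y 0 then (-t * y 0 + p * y 1 + q * y 2) ^ 2 else 0)
      (by rw [hR.map_eq]; exact hi.1)
    rwa [hR.map_eq] at this
  have c1 : ∀ y : Fin 3 → ℝ, (if -t * y 0 + p * y 1 + q * y 2 < 0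
      then (-t * y 0 + p * y 1 + q * y 2) ^ 2 else 0) = if p * y 1 + q * y 2 < t * y 0 then
      (-t * y 0 + p * y 1 + q * y 2) ^ 2 else 0 := by
    intro y
    refine if_congr ?_ rfl rfl
    constructor <;> intro h <;> linarith
  have c2 : ∀ y : Fin 3 → ℝ, (if 1 - (-t * y 0 + p * y 1 + q * y 2) < 0
      then (1 - (-t * y 0 + p * y 1 + q * y 2)) ^ 2 else 0)
      = if p * (1 - y 1) + q * (1 - y 2) < t * (1 - y 0) then
      (-t * (1 - y 0) + p * (1 - y 1) + q * (1 - y 2)) ^ 2 else 0 := by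
    intro y
    refine if_congr ?_ ?_ rfl
    · constructor <;> intro h <;> linarith
    · congr 1; linarith
  simp only [c1, c2]
  have hc : Integrable (fun y : Fin 3 → ℝ => (-t * y 0 + p * y 1 + q * y 2) ^ 2
      - (-t * y 0 + p * y 1 + q * y 2) + 1 / 2) (unifCube 3) :=
    integrable_unifCube_of_continuous (by fun_prop)
  have hl := integral_linear_combination hc hi hi' 1 (-1) (-1)
  simp only [Function.comp_def] at hl
  rw [← e'] at hl
  rw [show ∀ f g h : (Fin 3 → ℝ) → ℝ, ∫ y, (f y - g y - h y) ∂unifCube 3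
    = ∫ y, (1 * f y + -1 * g y + -1 * h y) ∂unifCube 3 from fun f g h => by
      congr 1; funext y; ring, hl]
  have d1 : ∫ y, ((-t * y 0 + p * y 1 + q * y 2) ^ 2
      - (-t * y 0 + p * y 1 + q * y 2) + 1 / 2) ∂unifCube 3 = _ :=
    Eq.trans (by congr 1; funext y; ring) k
  have d2 : ∫ y, (if p * y 1 + q * y 2 < t * y 0 then
      (-t * y 0 + p * y 1 + q * y 2) ^ 2 else 0) ∂unifCube 3 = _ :=
    Eq.trans (by congr 1; funext y; congr 1; ring) k2
  rw [d1, d2, meanAbs]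
  have hp0 := hp.ne'
  have hq0 := hq.ne'
  obtain rfl : t = p + q - 1 := by linarith
  field_simp
  ring

lemma unifCube_perm {n : ℕ} (σ : Equiv.Perm (Fin n)) :
    MeasurePreserving (fun (y : Fin n → ℝ) => y ∘ σ) (unifCube n) (unifCube n) := by
  have h := (measurePreserving_piCongrLeft (fun _ : Fin n => unif) σ).symm
  exact h

lemma meanLin_comp_perm (a : Fin 4 → ℝ) (σ : Equiv.Perm (Fin 4)) : meanLin (a ∘ σ) = meanLin a := by
  rw [meanLin, ← (unifCube_perm σ).lintegral_comp (by fun_prop), meanLin]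
  congr 1
  funext x
  rw [← Equiv.sum_comp σ fun i => a i * x i]
  rfl

lemma secMass_perm {p q p' q' : ℝ} (σ : Equiv.Perm (Fin 3))
    (hs : ∀ y, y ∘ σ ∈ slab p q ↔ y ∈ slab p' q')
    (hd : ∀ y z : Fin 3 → ℝ, (((y (σ 1) - y (σ 0)) * (z (σ 2) - z (σ 0))
      - (y (σ 2) - y (σ 0)) * (z (σ 1) - z (σ 0))) ^ 2)
      = (((y 1 - y 0) * (z 2 - z 0) - (y 2 - y 0) * (z 1 - z 0)) ^ 2)) :
    secMass p q = secMass p' q' := by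
  have hpre : (fun y : Fin 3 → ℝ => y ∘ σ) ⁻¹' slab p q = slab p' q' := Set.ext hs
  have hσ := (unifCube_perm σ).restrict_preimage (measurableSet_slab p q)
  rw [hpre] at hσ
  rw [secMass, ← hσ.lintegral_comp, secMass]
  · congr 1
    funext y
    rw [← hσ.lintegral_comp (by fun_prop)]
    congr 1
    funext z
    exact congrArg _ (hd y z)
  · exact Measurable.lintegral_prod_right' (f := fun x : (Fin 3 → ℝ) × (Fin 3 → ℝ) =>
      ENNReal.ofReal (((x.1 1 - x.1 0) * (x.2 2 - x.2 0)
        - (x.1 2 - x.1 0) * (x.2 1 - x.2 0)) ^ 2)) (by fun_prop)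

/-- The contribution of the intersection point with barycentric coordinates `1 - p - q, p, q`. -/
noncomputable def density (x : ℝ × ℝ) : ENNReal :=
  meanLin ![-1, 1 - x.1 - x.2, x.1, x.2] * secMass x.1 x.2

lemma density_swap (x : ℝ × ℝ) : density x.swap = density x := by
  unfold density
  congr 1
  · rw [← meanLin_comp_perm _ (Equiv.swap 2 3)]
    congr 1
    funext i
    fin_cases i <;> simp [Equiv.swap_apply_def]
    ring
  · refine secMass_perm (Equiv.swap 1 2) (fun y => ?_) fun y z => ?_
    · simp [slab, Equiv.swap_apply_def]
      ring_nf
    · simp [Equiv.swap_apply_def]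
      ring

lemma density_shear (x : ℝ × ℝ) : density (x.1, 1 - x.1 - x.2) = density x := by
  unfold density
  congr 1
  · rw [← meanLin_comp_perm _ (Equiv.swap 1 3)]
    congr 1
    funext i
    fin_cases i <;> simp [Equiv.swap_apply_def]
  · refine secMass_perm (Equiv.swap 0 2) (fun y => ?_) fun y z => ?_
    · simp [slab, Equiv.swap_apply_def]
      ring_nf
    · simp [Equiv.swap_apply_def]
      ring

lemma lintegral_triangle {f : ℝ × ℝ → ENNReal} {g : ℝ → ℝ → ℝ} {F : ℝ → ℝ}
    (hfg : ∀ t p, 0 < t → t ≤ p → p ≤ 1 → f (t, p) = ENNReal.ofReal (g t p))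
    (hg0 : ∀ t p, 0 < t → t ≤ p → p ≤ 1 → 0 ≤ g t p)
    (hg : ContinuousOn (Function.uncurry g) {x | 0 < x.1 ∧ x.1 ≤ x.2 ∧ x.2 ≤ 1})
    (hF : ∀ t, 0 < t → t ≤ 1 → ∫ p in t..1, g t p = F t) (hFi : IntervalIntegrable F volume 0 1) :
    ∫⁻ x in {x : ℝ × ℝ | 0 < x.1 ∧ x.1 ≤ x.2 ∧ x.2 ≤ 1}, f x
      = ENNReal.ofReal (∫ t in (0:ℝ)..1, F t) := by
  set R := {x : ℝ × ℝ | 0 < x.1 ∧ x.1 ≤ x.2 ∧ x.2 ≤ 1} with hR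
  have hRm : MeasurableSet R :=
    ((measurableSet_lt measurable_const measurable_fst).inter
      ((measurableSet_le measurable_fst measurable_snd).inter
        (measurableSet_le measurable_snd measurable_const)))
  have h1 : ∫⁻ x in R, f x = ∫⁻ x in R, ENNReal.ofReal (Function.uncurry g x) :=
    setLIntegral_congr_fun hRm fun x hx => hfg x.1 x.2 hx.1 hx.2.1 hx.2.2
  have hmeas : AEMeasurable (fun x => R.indicator (fun x => ENNReal.ofReal (Function.uncurry g x)) x)
      ((volume : Measure ℝ).prod volume) :=
    (aemeasurable_indicator_iff hRm).2 (hg.aemeasurable hRm).ennreal_ofReal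
  rw [h1, ← lintegral_indicator hRm, Measure.volume_eq_prod, lintegral_prod _ hmeas,
    intervalIntegral.integral_of_le zero_le_one]
  have hin : ∀ t, ∫⁻ p, R.indicator (fun x => ENNReal.ofReal (Function.uncurry g x)) (t, p)
      = (Set.Ioc 0 1).indicator (fun t => ENNReal.ofReal (F t)) t ∧
      (t ∈ Set.Ioc 0 1 → 0 ≤ F t) := by
    intro t
    by_cases ht : t ∈ Set.Ioc (0:ℝ) 1
    · have hc : ContinuousOn (g t) (Set.Icc t 1) :=
        hg.comp (f := fun p => (t, p)) (by fun_prop) fun p hp => ⟨ht.1, hp.1, hp.2⟩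
      have hnn : 0 ≤ᵐ[volume.restrict (Set.Icc t 1)] g t :=
        (ae_restrict_mem measurableSet_Icc).mono fun p hp => hg0 t p ht.1 hp.1 hp.2
      have hFt := hF t ht.1 ht.2
      rw [intervalIntegral.integral_of_le ht.2, ← integral_Icc_eq_integral_Ioc] at hFt
      rw [Set.indicator_of_mem ht, ← hFt]
      refine ⟨?_, fun _ => integral_nonneg_of_ae hnn⟩
      rw [ofReal_integral_eq_lintegral_ofReal (hc.integrableOn_Icc) hnn,
        ← lintegral_indicator measurableSet_Icc]
      congr 1
      funext p
      by_cases hp : p ∈ Set.Icc t 1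
      · rw [Set.indicator_of_mem hp, Set.indicator_of_mem (show (t, p) ∈ R from ⟨ht.1, hp.1, hp.2⟩)]
        rfl
      · rw [Set.indicator_of_notMem hp, Set.indicator_of_notMem fun h => hp h.2]
    · refine ⟨?_, fun h => absurd h ht⟩
      rw [Set.indicator_of_notMem ht]
      rw [show (fun p => R.indicator (fun x => ENNReal.ofReal (Function.uncurry g x)) (t, p))
        = fun _ => 0 from ?_, lintegral_zero]
      funext p
      exact Set.indicator_of_notMem (fun h => ht ⟨h.1, h.2.1.trans h.2.2⟩) _
  simp only [fun t => (hin t).1]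
  rw [lintegral_indicator measurableSet_Ioc, ofReal_integral_eq_lintegral_ofReal
    ((intervalIntegrable_iff_integrableOn_Ioc_of_le zero_le_one).1 hFi)
    ((ae_restrict_mem measurableSet_Ioc).mono fun t ht => (hin t).2 ht)]

lemma secMass_eq (p q : ℝ) : secMass p q = ∫⁻ y, ∫⁻ z, (slab p q ×ˢ slab p q).indicator
    (fun w => ENNReal.ofReal (((w.1 1 - w.1 0) * (w.2 2 - w.2 0)
      - (w.1 2 - w.1 0) * (w.2 1 - w.2 0)) ^ 2)) (y, z) ∂unifCube 3 ∂unifCube 3 := by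
  have hm := measurableSet_slab p q
  rw [secMass, ← lintegral_indicator hm]
  congr 1
  funext y
  by_cases hy : y ∈ slab p q
  · rw [Set.indicator_of_mem hy, ← lintegral_indicator hm]
    congr 1
    funext z
    by_cases hz : z ∈ slab p q
    · rw [Set.indicator_of_mem hz, Set.indicator_of_mem (Set.mk_mem_prod hy hz)]
    · rw [Set.indicator_of_notMem hz, Set.indicator_of_notMem fun h => hz h.2]
  · rw [Set.indicator_of_notMem hy]
    simp [Set.indicator, hy]

lemma measurable_slab_indicator {f : (Fin 3 → ℝ) × (Fin 3 → ℝ) → ENNReal} (hf : Measurable f) :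
    Measurable fun x : ((ℝ × ℝ) × (Fin 3 → ℝ)) × (Fin 3 → ℝ) =>
      (slab x.1.1.1 x.1.1.2 ×ˢ slab x.1.1.1 x.1.1.2).indicator f (x.1.2, x.2) := by
  simp only [Set.indicator, Set.mem_prod, slab, Set.mem_ofPred_eq]
  refine Measurable.ite ?_ (by fun_prop) measurable_const
  refine MeasurableSet.inter ?_ ?_
  · exact measurableSet_Icc.preimage (f := fun x : ((ℝ × ℝ) × (Fin 3 → ℝ)) × (Fin 3 → ℝ) =>
      (1 - x.1.1.1 - x.1.1.2) * x.1.2 0 + x.1.1.1 * x.1.2 1 + x.1.1.2 * x.1.2 2) (by fun_prop)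
  · exact measurableSet_Icc.preimage (f := fun x : ((ℝ × ℝ) × (Fin 3 → ℝ)) × (Fin 3 → ℝ) =>
      (1 - x.1.1.1 - x.1.1.2) * x.2 0 + x.1.1.1 * x.2 1 + x.1.1.2 * x.2 2) (by fun_prop)

lemma measurable_density : Measurable density := by
  refine Measurable.mul ?_ ?_
  · refine Measurable.lintegral_prod_right' (f := fun x : (ℝ × ℝ) × (Fin 4 → ℝ) =>
      ENNReal.ofReal |∑ i, (![-1, 1 - x.1.1 - x.1.2, x.1.1, x.1.2] : Fin 4 → ℝ) i * x.2 i|) ?_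
    simp only [Fin.sum_univ_four, Matrix.cons_val_zero, Matrix.cons_val_one, Matrix.cons_val]
    fun_prop
  · simp only [secMass_eq]
    refine Measurable.lintegral_prod_right' (f := fun x : (ℝ × ℝ) × (Fin 3 → ℝ) => ∫⁻ z,
      (slab x.1.1 x.1.2 ×ˢ slab x.1.1 x.1.2).indicator _ (x.2, z) ∂unifCube 3) ?_
    exact (measurable_slab_indicator (by fun_prop)).lintegral_prod_right'

lemma measurePreserving_shear :
    MeasurePreserving (fun x : ℝ × ℝ => (x.1, 1 - x.1 - x.2)) := by
  rw [Measure.volume_eq_prod]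
  refine (MeasurePreserving.id volume).skew_product (g := fun a b => 1 - a - b) (by fun_prop)
    (ae_of_all _ fun a => ?_)
  exact (Measure.measurePreserving_sub_left volume (1 - a)).map_eq

lemma measurePreserving_swap_real : MeasurePreserving (Prod.swap : ℝ × ℝ → ℝ × ℝ) :=
  Measure.measurePreserving_swap

lemma measurePreserving_reflect_swap :
    MeasurePreserving (fun x : ℝ × ℝ => (1 - x.2, x.1)) := by
  have h := ((Measure.measurePreserving_sub_left (volume : Measure ℝ) 1).prod
    (MeasurePreserving.id (volume : Measure ℝ)))
  exact h.comp measurePreserving_swap_real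

lemma meanAbs_nonneg {p q t : ℝ} (ht : 0 < t) (htp : t ≤ p) (htq : t ≤ q) :
    0 ≤ meanAbs p q t := by
  have hp := ht.trans_le htp
  have hq := ht.trans_le htq
  have h1 : t ^ 2 ≤ p * q := by nlinarith
  have h2 : t ^ 4 / (30 * (p * q)) ≤ t ^ 2 / 30 := by
    rw [div_le_div_iff₀ (by positivity) (by norm_num)]
    nlinarith [mul_le_mul_of_nonneg_left h1 (sq_nonneg t)]
  unfold meanAbs
  nlinarith [sq_nonneg t, sq_nonneg p, sq_nonneg q]

lemma setLIntegral_density_of_one_lt :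
    ∫⁻ x in {x : ℝ × ℝ | x.1 ≤ 1 ∧ x.2 ≤ 1 ∧ 1 < x.1 + x.2}, density x
      = ENNReal.ofReal (517 / 72000 - Real.pi ^ 2 / 4320) := by
  have hψ : MeasurePreserving (fun x : ℝ × ℝ => (x.2, 1 + x.1 - x.2)) := by
    have h := measurePreserving_shear.comp (measurePreserving_swap_real.comp
      ((Measure.measurePreserving_sub_left (volume : Measure ℝ) 0).prod
        (MeasurePreserving.id (volume : Measure ℝ))))
    have e : (fun x : ℝ × ℝ => (x.2, 1 + x.1 - x.2)) = (fun x => (x.1, 1 - x.1 - x.2)) ∘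
        Prod.swap ∘ Prod.map (fun t => 0 - t) id := by
      funext x
      simp
      ring
    rw [e]
    exact h
  have hS : MeasurableSet {x : ℝ × ℝ | x.1 ≤ 1 ∧ x.2 ≤ 1 ∧ 1 < x.1 + x.2} :=
    (measurableSet_le measurable_fst measurable_const).inter
      ((measurableSet_le measurable_snd measurable_const).inter
        (measurableSet_lt measurable_const (measurable_fst.add measurable_snd)))
  rw [← hψ.setLIntegral_comp_preimage hS measurable_density, ← integral_lineIntegral]
  have hpre : (fun x : ℝ × ℝ => (x.2, 1 + x.1 - x.2)) ⁻¹'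
      {x : ℝ × ℝ | x.1 ≤ 1 ∧ x.2 ≤ 1 ∧ 1 < x.1 + x.2}
      = {x : ℝ × ℝ | 0 < x.1 ∧ x.1 ≤ x.2 ∧ x.2 ≤ 1} := by
    ext x
    simp only [Set.mem_preimage, Set.mem_ofPred_eq]
    constructor <;> rintro ⟨h1, h2, h3⟩ <;> refine ⟨?_, ?_, ?_⟩ <;> linarith
  rw [hpre]
  refine lintegral_triangle (g := fun t p => 2 * secDet (t / p) (t / (1 + t - p))
    * meanAbs p (1 + t - p) t) ?_ ?_ ?_ (fun t h0 h1 => integral_secDet_meanAbs h0 h1) ?_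
  · intro t p ht htp hp
    have hp0 : 0 < p := by linarith
    have hq0 : 0 < 1 + t - p := by linarith
    obtain ⟨h0, h1⟩ := secMass_of_one_le hp0 hq0 ht.le htp (by linarith) (by ring)
    simp only [density]
    rw [h1, meanLin_of_one_le hp0 hq0 ht.le htp (by linarith) (by ring), mul_comm,
      ← ENNReal.ofReal_mul h0]
  · intro t p ht htp hp
    have hp0 : 0 < p := by linarith
    have hq0 : 0 < 1 + t - p := by linarith
    exact mul_nonneg (secMass_of_one_le hp0 hq0 ht.le htp (by linarith) (by ring)).1
      (meanAbs_nonneg ht htp (by linarith))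
  · have h1 : ∀ x ∈ {x : ℝ × ℝ | 0 < x.1 ∧ x.1 ≤ x.2 ∧ x.2 ≤ 1}, x.2 ≠ 0 :=
      fun x hx => (hx.1.trans_le hx.2.1).ne'
    have h2 : ∀ x ∈ {x : ℝ × ℝ | 0 < x.1 ∧ x.1 ≤ x.2 ∧ x.2 ≤ 1}, 1 + x.1 - x.2 ≠ 0 :=
      fun x hx => by have := hx.1; have := hx.2.2; linarith
    have h3 : ∀ x ∈ {x : ℝ × ℝ | 0 < x.1 ∧ x.1 ≤ x.2 ∧ x.2 ≤ 1}, 30 * (x.2 * (1 + x.1 - x.2)) ≠ 0 :=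
      fun x hx => mul_ne_zero (by norm_num) (mul_ne_zero (h1 x hx) (h2 x hx))
    simp only [Function.uncurry_def, secDet, meanAbs]
    fun_prop (disch := assumption)
  · exact ContinuousOn.intervalIntegrable (by
      rw [Set.uIcc_of_le zero_le_one]; exact continuousOn_lineIntegral)

lemma setLIntegral_density_of_nonneg :
    ∫⁻ x in {x : ℝ × ℝ | 0 ≤ x.1 ∧ 0 < x.2 ∧ x.1 + x.2 ≤ 1}, density x
      = ENNReal.ofReal (7 / 1152) := by
  have hS : MeasurableSet {x : ℝ × ℝ | 0 ≤ x.1 ∧ 0 < x.2 ∧ x.1 + x.2 ≤ 1} :=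
    (measurableSet_le measurable_const measurable_fst).inter
      ((measurableSet_lt measurable_const measurable_snd).inter
        (measurableSet_le (measurable_fst.add measurable_snd) measurable_const))
  have hpre : (fun x : ℝ × ℝ => (1 - x.2, x.1)) ⁻¹'
      {x : ℝ × ℝ | 0 ≤ x.1 ∧ 0 < x.2 ∧ x.1 + x.2 ≤ 1}
      = {x : ℝ × ℝ | 0 < x.1 ∧ x.1 ≤ x.2 ∧ x.2 ≤ 1} := by
    ext x
    simp only [Set.mem_preimage, Set.mem_ofPred_eq]
    constructor <;> rintro ⟨h1, h2, h3⟩ <;> refine ⟨?_, ?_, ?_⟩ <;> linarith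
  have hF : ∫ t in (0:ℝ)..1, ((1 - t) / 4 + (2 * (1 - t) ^ 3 / 3 + t ^ 2 * (1 - t)) / 12) / 24
      = 7 / 1152 := by
    rw [integral_of_eq_poly (11 / 864) (-5 / 288) (1 / 96) (-5 / 864) 0 (fun t => by ring)]
    norm_num
  rw [← measurePreserving_reflect_swap.setLIntegral_comp_preimage hS measurable_density, hpre,
    ← hF]
  refine lintegral_triangle (g := fun t p =>
    (1 / 4 + ((1 - p) ^ 2 + t ^ 2 + (p - t) ^ 2) / 12) * (1 / 24)) ?_ ?_ ?_ ?_ ?_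
  · intro t p ht htp hp
    simp only [density]
    rw [secMass_of_nonneg (by linarith) ht.le (by linarith), meanLin_of_nonneg (by linarith)
      (by linarith) ht.le (by ring), ENNReal.ofReal_mul (by positivity)]
    congr 3
    ring
  · intro t p _ _ _
    positivity
  · exact Continuous.continuousOn (by simp only [Function.uncurry_def]; fun_prop)
  · intro t _ _
    have hd : ∀ p ∈ Set.uIcc t 1, HasDerivAt (fun p : ℝ => (p / 4 + ((p - 1) ^ 3 / 3 + t ^ 2 * p
        + (p - t) ^ 3 / 3) / 12) * (1 / 24))
        ((1 / 4 + ((1 - p) ^ 2 + t ^ 2 + (p - t) ^ 2) / 12) * (1 / 24)) p := by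
      intro p _
      have hi := hasDerivAt_id p
      have e := ((hi.div_const 4).add ((((((hi.sub_const 1).pow 3).div_const 3).add
        (hi.const_mul (t ^ 2))).add (((hi.sub_const t).pow 3).div_const 3)).div_const 12)).mul_const
          (1 / 24 : ℝ)
      refine e.congr_deriv ?_
      simp only [id]
      push_cast
      ring
    rw [intervalIntegral.integral_eq_sub_of_hasDerivAt hd
      (Continuous.intervalIntegrable (by fun_prop) _ _)]
    ring
  · exact Continuous.intervalIntegrable (by fun_prop) _ _

lemma setLIntegral_density :
    ∫⁻ x in {x : ℝ × ℝ | x.1 ≤ 1 ∧ x.2 ≤ 1 ∧ 0 ≤ x.1 + x.2}, density x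
      = ENNReal.ofReal (3977 / 144000 - Real.pi ^ 2 / 1440) := by
  set A := {x : ℝ × ℝ | 0 ≤ x.1 ∧ 0 < x.2 ∧ x.1 + x.2 ≤ 1}
  set B := {x : ℝ × ℝ | x.1 ≤ 1 ∧ x.2 ≤ 1 ∧ 1 < x.1 + x.2}
  set C := {x : ℝ × ℝ | x.1 ≤ 1 ∧ x.2 < 0 ∧ 0 ≤ x.1 + x.2}
  set D := {x : ℝ × ℝ | x.1 < 0 ∧ x.2 ≤ 1 ∧ 0 ≤ x.1 + x.2}
  have mB : MeasurableSet B :=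
    (measurableSet_le measurable_fst measurable_const).inter
      ((measurableSet_le measurable_snd measurable_const).inter
        (measurableSet_lt measurable_const (measurable_fst.add measurable_snd)))
  have mC : MeasurableSet C :=
    (measurableSet_le measurable_fst measurable_const).inter
      ((measurableSet_lt measurable_snd measurable_const).inter
        (measurableSet_le measurable_const (measurable_fst.add measurable_snd)))
  have mD : MeasurableSet D :=
    (measurableSet_lt measurable_fst measurable_const).inter
      ((measurableSet_le measurable_snd measurable_const).inter
        (measurableSet_le measurable_const (measurable_fst.add measurable_snd)))
  have hC : ∫⁻ x in C, density x = ∫⁻ x in B, density x := by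
    rw [← measurePreserving_shear.setLIntegral_comp_preimage mB measurable_density]
    simp only [density_shear]
    congr 2
    ext x
    simp only [C, B, Set.mem_preimage, Set.mem_ofPred_eq]
    constructor <;> rintro ⟨h1, h2, h3⟩ <;> refine ⟨?_, ?_, ?_⟩ <;> linarith
  have hD : ∫⁻ x in D, density x = ∫⁻ x in C, density x := by
    rw [← measurePreserving_swap_real.setLIntegral_comp_preimage mC measurable_density]
    simp only [density_swap]
    congr 2
    ext x
    simp only [C, D, Set.mem_preimage, Set.mem_ofPred_eq, Prod.fst_swap, Prod.snd_swap]
    constructor <;> rintro ⟨h1, h2, h3⟩ <;> refine ⟨?_, ?_, ?_⟩ <;> linarith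
  have hT : {x : ℝ × ℝ | x.1 ≤ 1 ∧ x.2 ≤ 1 ∧ 0 ≤ x.1 + x.2}
      =ᵐ[volume] (((A ∪ B) ∪ C) ∪ D : Set (ℝ × ℝ)) := by
    have h0 : ∀ᵐ x : ℝ × ℝ, x.2 ≠ 0 :=
      Measure.quasiMeasurePreserving_snd.ae (Measure.ae_ne volume 0)
    filter_upwards [h0] with x hx
    apply propext
    change (x ∈ {x : ℝ × ℝ | x.1 ≤ 1 ∧ x.2 ≤ 1 ∧ 0 ≤ x.1 + x.2}) ↔ x ∈ (((A ∪ B) ∪ C) ∪ D)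
    simp only [A, B, C, D, Set.mem_union, Set.mem_ofPred_eq]
    constructor
    · rintro ⟨h1, h2, h3⟩
      by_cases hp : x.1 < 0
      · exact Or.inr ⟨hp, h2, h3⟩
      rcases lt_or_gt_of_ne hx with hq | hq
      · exact Or.inl (Or.inr ⟨h1, hq, h3⟩)
      by_cases hr : 1 < x.1 + x.2
      · exact Or.inl (Or.inl (Or.inr ⟨h1, h2, hr⟩))
      · exact Or.inl (Or.inl (Or.inl ⟨not_lt.1 hp, hq, not_lt.1 hr⟩))
    · rintro (((⟨h1, h2, h3⟩ | ⟨h1, h2, h3⟩) | ⟨h1, h2, h3⟩) | ⟨h1, h2, h3⟩) <;>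
        refine ⟨?_, ?_, ?_⟩ <;> linarith
  have dD : Disjoint (A ∪ B ∪ C) D := by
    rw [Set.disjoint_left]
    rintro x ((⟨h1, h2, h3⟩ | ⟨h1, h2, h3⟩) | ⟨h1, h2, h3⟩) ⟨h4, h5, h6⟩ <;> linarith
  have dC : Disjoint (A ∪ B) C := by
    rw [Set.disjoint_left]
    rintro x (⟨h1, h2, h3⟩ | ⟨h1, h2, h3⟩) ⟨h4, h5, h6⟩ <;> linarith
  have dB : Disjoint A B := by
    rw [Set.disjoint_left]
    rintro x ⟨h1, h2, h3⟩ ⟨h4, h5, h6⟩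
    linarith
  have hpi : 0 ≤ 517 / 72000 - Real.pi ^ 2 / 4320 := by
    nlinarith [Real.pi_lt_d2, Real.pi_gt_three]
  rw [setLIntegral_congr hT, lintegral_union mD dD, lintegral_union mC dC, lintegral_union mB dB,
    hD, hC, setLIntegral_density_of_one_lt, setLIntegral_density_of_nonneg,
    ← ENNReal.ofReal_add (by norm_num) hpi, ← ENNReal.ofReal_add (by positivity) hpi,
    ← ENNReal.ofReal_add (by positivity) hpi]
  congr 1
  ring

/-- Twice the signed area of the triangle with vertices `(Y i, Z i), (Y j, Z j), (Y k, Z k)`. -/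
def tri {n : ℕ} (i j k : Fin n) (Y Z : Fin n → ℝ) : ℝ :=
  (Y j - Y i) * (Z k - Z i) - (Y k - Y i) * (Z j - Z i)

/-- The cofactors of the column `X` in the determinant with columns `1, X, Y, Z`. -/
def cof (Y Z : Fin 4 → ℝ) : Fin 4 → ℝ :=
  ![-tri 1 2 3 Y Z, tri 0 2 3 Y Z, -tri 0 1 3 Y Z, tri 0 1 2 Y Z]

lemma cof_comp_swap (k : Fin 4) (hk : k ≠ 0) (Y Z : Fin 4 → ℝ) :
    cof (Y ∘ Equiv.swap 0 k) (Z ∘ Equiv.swap 0 k) = fun i => -1 * (cof Y Z ∘ Equiv.swap 0 k) i := by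
  funext i
  fin_cases k
  · exact absurd rfl hk
  all_goals
    fin_cases i <;> simp [cof, tri, Equiv.swap_apply_def] <;> ring

lemma measurable_cof : Measurable fun x : (Fin 4 → ℝ) × (Fin 4 → ℝ) => cof x.1 x.2 := by
  rw [measurable_pi_iff]
  intro i
  fin_cases i <;> simp [cof, tri] <;> fun_prop

lemma measurable_cof_right (Y : Fin 4 → ℝ) : Measurable fun Z => cof Y Z :=
  measurable_cof.comp (measurable_prodMk_left (x := Y))

lemma measurable_meanLin : Measurable meanLin := by
  refine Measurable.lintegral_prod_right' (f := fun x : (Fin 4 → ℝ) × (Fin 4 → ℝ) =>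
      ENNReal.ofReal |∑ i, x.1 i * x.2 i|) ?_
  fun_prop

lemma meanLin_smul (c : ℝ) (a : Fin 4 → ℝ) :
    meanLin (fun i => c * a i) = ENNReal.ofReal |c| * meanLin a := by
  rw [meanLin, meanLin, ← lintegral_const_mul _ (by fun_prop)]
  congr 1
  funext x
  rw [← ENNReal.ofReal_mul (abs_nonneg c), ← abs_mul, Finset.mul_sum]
  simp only [mul_assoc]

/-- Whether the coordinate `k` has maximal absolute value. -/
noncomputable def isMax (k : Fin 4) (a : Fin 4 → ℝ) : ENNReal :=
  if ∀ j, |a j| ≤ |a k| then 1 else 0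

/-- A partition of unity according to the coordinate of maximal absolute value. -/
noncomputable def maxWeight (k : Fin 4) (a : Fin 4 → ℝ) : ENNReal :=
  isMax k a * (∑ i, isMax i a)⁻¹

lemma measurable_isMax (k : Fin 4) : Measurable (isMax k) := by
  refine Measurable.ite ?_ measurable_const measurable_const
  rw [Set.ofPred_forall]
  exact MeasurableSet.iInter fun j => measurableSet_le (by fun_prop) (by fun_prop)

lemma measurable_maxWeight (k : Fin 4) : Measurable (maxWeight k) :=
  (measurable_isMax k).mul (Finset.measurable_sum _ fun i _ => measurable_isMax i).inv

lemma sum_maxWeight (a : Fin 4 → ℝ) : ∑ k, maxWeight k a = 1 := by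
  simp only [maxWeight]
  rw [← Finset.sum_mul]
  refine ENNReal.mul_inv_cancel ?_ ?_
  · obtain ⟨k, hk⟩ := Finite.exists_max fun i => |a i|
    intro h
    have := (Finset.sum_eq_zero_iff.1 h) k (Finset.mem_univ k)
    rw [isMax, if_pos hk] at this
    exact one_ne_zero this
  · refine ENNReal.sum_ne_top.2 fun i _ => ?_
    unfold isMax
    split_ifs <;> simp

lemma isMax_smul {c : ℝ} (hc : c ≠ 0) (k : Fin 4) (a : Fin 4 → ℝ) :
    isMax k (fun i => c * a i) = isMax k a := by
  simp only [isMax, abs_mul, mul_le_mul_iff_right₀ (abs_pos.2 hc)]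

lemma maxWeight_smul {c : ℝ} (hc : c ≠ 0) (k : Fin 4) (a : Fin 4 → ℝ) :
    maxWeight k (fun i => c * a i) = maxWeight k a := by
  simp only [maxWeight, isMax_smul hc]

lemma isMax_comp_perm (σ : Equiv.Perm (Fin 4)) (k : Fin 4) (a : Fin 4 → ℝ) :
    isMax k (a ∘ σ) = isMax (σ k) a := by
  simp only [isMax, Function.comp]
  refine if_congr ?_ rfl rfl
  exact ⟨fun h j => by simpa using h (σ.symm j), fun h j => h (σ j)⟩

lemma maxWeight_comp_perm (σ : Equiv.Perm (Fin 4)) (k : Fin 4) (a : Fin 4 → ℝ) :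
    maxWeight k (a ∘ σ) = maxWeight (σ k) a := by
  simp only [maxWeight, isMax_comp_perm]
  rw [Equiv.sum_comp σ fun i => isMax i a]

/-- The part of `meanLin` where the first coefficient is maximal. -/
noncomputable def headMean (a : Fin 4 → ℝ) : ENNReal := meanLin a * maxWeight 0 a

lemma measurable_headMean : Measurable headMean := measurable_meanLin.mul (measurable_maxWeight 0)

lemma headMean_smul {c : ℝ} (hc : c ≠ 0) (a : Fin 4 → ℝ) :
    headMean (fun i => c * a i) = ENNReal.ofReal |c| * headMean a := by
  rw [headMean, meanLin_smul, maxWeight_smul hc, headMean, mul_assoc]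

lemma headMean_eq_zero {a : Fin 4 → ℝ} (h : a 0 = 0) : headMean a = 0 := by
  by_cases h0 : ∀ j, |a j| ≤ |a 0|
  · have : a = fun i => 0 * a i := by
      funext i
      have := h0 i
      rw [h, abs_zero] at this
      rw [zero_mul]
      exact abs_nonpos_iff.1 this
    rw [headMean, this, meanLin_smul]
    simp
  · simp [headMean, maxWeight, isMax, h0]

lemma lintegral_lintegral_comp_perm {n : ℕ} (σ : Equiv.Perm (Fin n))
    {F : (Fin n → ℝ) × (Fin n → ℝ) → ENNReal} (hF : Measurable F) :
    ∫⁻ Y, ∫⁻ Z, F (Y ∘ σ, Z ∘ σ) ∂unifCube n ∂unifCube n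
      = ∫⁻ Y, ∫⁻ Z, F (Y, Z) ∂unifCube n ∂unifCube n := by
  have hσ := unifCube_perm σ
  rw [← hσ.lintegral_comp hF.lintegral_prod_right']
  exact lintegral_congr fun Y => hσ.lintegral_comp (hF.comp measurable_prodMk_left)

lemma lintegral_meanLin_cof :
    ∫⁻ Y, ∫⁻ Z, meanLin (cof Y Z) ∂unifCube 4 ∂unifCube 4
      = 4 * ∫⁻ Y, ∫⁻ Z, headMean (cof Y Z) ∂unifCube 4 ∂unifCube 4 := by
  have hm : ∀ k, Measurable fun x : (Fin 4 → ℝ) × (Fin 4 → ℝ) =>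
      meanLin (cof x.1 x.2) * maxWeight k (cof x.1 x.2) := fun k =>
    (measurable_meanLin.comp measurable_cof).mul ((measurable_maxWeight k).comp measurable_cof)
  have hk : ∀ k, ∫⁻ Y, ∫⁻ Z, meanLin (cof Y Z) * maxWeight k (cof Y Z) ∂unifCube 4 ∂unifCube 4
      = ∫⁻ Y, ∫⁻ Z, headMean (cof Y Z) ∂unifCube 4 ∂unifCube 4 := by
    intro k
    by_cases h : k = 0
    · simp only [h, headMean]
    refine (lintegral_lintegral_comp_perm (Equiv.swap 0 k) (hm k)).symm.trans ?_
    refine lintegral_congr fun Y => lintegral_congr fun Z => ?_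
    simp only
    rw [cof_comp_swap k h, meanLin_smul, maxWeight_smul (by norm_num), maxWeight_comp_perm,
      meanLin_comp_perm, Equiv.swap_apply_right, headMean]
    simp
  have hY : ∀ k Y, Measurable fun Z => meanLin (cof Y Z) * maxWeight k (cof Y Z) :=
    fun k Y => (measurable_meanLin.comp (measurable_cof_right Y)).mul
      ((measurable_maxWeight k).comp (measurable_cof_right Y))
  calc _ = ∫⁻ Y, ∫⁻ Z, ∑ k, meanLin (cof Y Z) * maxWeight k (cof Y Z) ∂unifCube 4 ∂unifCube 4 := by
        simp only [← Finset.mul_sum, sum_maxWeight, mul_one]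
    _ = ∫⁻ Y, ∑ k, ∫⁻ Z, meanLin (cof Y Z) * maxWeight k (cof Y Z) ∂unifCube 4 ∂unifCube 4 :=
        lintegral_congr fun Y => lintegral_finsetSum Finset.univ fun k _ => hY k Y
    _ = ∑ k, ∫⁻ Y, ∫⁻ Z, meanLin (cof Y Z) * maxWeight k (cof Y Z) ∂unifCube 4 ∂unifCube 4 :=
        lintegral_finsetSum Finset.univ fun k _ => (hm k).lintegral_prod_right'
    _ = _ := by
      rw [Finset.sum_congr rfl fun k _ => hk k, Finset.sum_const, Finset.card_univ,
        Fintype.card_fin, nsmul_eq_mul, Nat.cast_ofNat]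

/-- The coefficients expressing a point through its barycentric coordinates. -/
def bary (x : ℝ × ℝ) : Fin 4 → ℝ := ![-1, 1 - x.1 - x.2, x.1, x.2]

lemma cof_cons (y z : Fin 3 → ℝ) (x : ℝ × ℝ) :
    cof (Fin.cons ((1 - x.1 - x.2) * y 0 + x.1 * y 1 + x.2 * y 2) y)
      (Fin.cons ((1 - x.1 - x.2) * z 0 + x.1 * z 1 + x.2 * z 2) z)
      = fun i => tri 0 1 2 y z * bary x i := by
  have e : ∀ (c : ℝ) (w : Fin 3 → ℝ), (Fin.cons c w : Fin 4 → ℝ) = ![c, w 0, w 1, w 2] := by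
    intro c w
    funext i
    fin_cases i <;> rfl
  funext i
  fin_cases i <;> simp [cof, tri, bary, e] <;> ring

lemma lintegral_comp_affine {a b c d : ℝ} (h : a * d - b * c ≠ 0) (v : ℝ × ℝ)
    {F : ℝ × ℝ → ENNReal} (hF : Measurable F) :
    ∫⁻ x, F x = ENNReal.ofReal |a * d - b * c|
      * ∫⁻ x : ℝ × ℝ, F (v.1 + (a * x.1 + b * x.2), v.2 + (c * x.1 + d * x.2)) := by
  set f : ℝ × ℝ →ₗ[ℝ] ℝ × ℝ :=
    Matrix.toLin (Module.Basis.finTwoProd ℝ) (Module.Basis.finTwoProd ℝ) !![a, b; c, d] with hf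
  have hdet : LinearMap.det f = a * d - b * c := by
    rw [hf, LinearMap.det_toLin, Matrix.det_fin_two_of]
  have hfx : ∀ x, f x = (a * x.1 + b * x.2, c * x.1 + d * x.2) := fun x => by
    rw [hf, Matrix.toLin_finTwoProd_apply]
  have hmap := Measure.map_linearMap_addHaar_eq_smul_addHaar (volume : Measure (ℝ × ℝ))
    (f := f) (by rwa [hdet])
  have hfm : Measurable f := (LinearMap.continuous_of_finiteDimensional f).measurable
  have h1 := lintegral_map (μ := volume) (f := fun x => F (v + x)) (by fun_prop) hfm
  rw [hmap, lintegral_smul_measure, lintegral_add_left_eq_self F v, hdet] at h1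
  have h2 : ∀ x : ℝ × ℝ, F (v.1 + (a * x.1 + b * x.2), v.2 + (c * x.1 + d * x.2)) = F (v + f x) :=
    fun x => by rw [hfx]; rfl
  simp only [h2]
  rw [← h1, smul_eq_mul, ← mul_assoc, ← ENNReal.ofReal_mul (abs_nonneg _), ← abs_mul,
    mul_inv_cancel₀ h, abs_one, ENNReal.ofReal_one, one_mul]

lemma measurable_bary : Measurable bary := by
  rw [measurable_pi_iff]
  intro i
  fin_cases i <;> simp [bary] <;> fun_prop

/-- Replacing the coordinates of the first vertex by its barycentric coordinates. -/
lemma lintegral_headMean_cons (y z : Fin 3 → ℝ) :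
    ∫⁻ s, ∫⁻ t, headMean (cof (Fin.cons s y) (Fin.cons t z)) ∂unif ∂unif
      = ∫⁻ x : ℝ × ℝ, headMean (bary x) * (slab x.1 x.2 ×ˢ slab x.1 x.2).indicator
        (fun w => ENNReal.ofReal (tri 0 1 2 w.1 w.2 ^ 2)) (y, z) := by
  have hhead : ∀ s t, cof (Fin.cons s y) (Fin.cons t z) 0 = -tri 0 1 2 y z := fun s t => rfl
  by_cases hJ : tri 0 1 2 y z = 0
  · have h1 : ∀ s t, headMean (cof (Fin.cons s y) (Fin.cons t z)) = 0 := fun s t =>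
      headMean_eq_zero (by rw [hhead, hJ, neg_zero])
    simp only [h1]
    rw [lintegral_zero, lintegral_zero, eq_comm]
    rw [← lintegral_zero (μ := (volume : Measure (ℝ × ℝ)))]
    congr 1
    funext x
    simp [Set.indicator, hJ]
  · have hcons : ∀ w : Fin 3 → ℝ, Measurable fun s : ℝ => (Fin.cons s w : Fin 4 → ℝ) := fun w =>
      (measurePreserving_cons unif 3).measurable.comp measurable_prodMk_right
    have hm : Measurable fun x : ℝ × ℝ => headMean (cof (Fin.cons x.1 y) (Fin.cons x.2 z)) :=
      measurable_headMean.comp (measurable_cof.comp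
        (((hcons y).comp measurable_fst).prodMk ((hcons z).comp measurable_snd)))
    have hS : MeasurableSet (Set.Icc (0:ℝ) 1 ×ˢ Set.Icc (0:ℝ) 1) :=
      measurableSet_Icc.prod measurableSet_Icc
    rw [← lintegral_prod (fun x : ℝ × ℝ => headMean (cof (Fin.cons x.1 y) (Fin.cons x.2 z)))
      hm.aemeasurable, unif, Measure.prod_restrict, ← lintegral_indicator hS,
      ← Measure.volume_eq_prod]
    rw [lintegral_comp_affine (a := y 1 - y 0) (b := y 2 - y 0) (c := z 1 - z 0) (d := z 2 - z 0)
      hJ (y 0, z 0) (hm.indicator hS), ← lintegral_const_mul' _ _ ENNReal.ofReal_ne_top]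
    congr 1
    funext x
    have e : ∀ w : Fin 3 → ℝ, w 0 + ((w 1 - w 0) * x.1 + (w 2 - w 0) * x.2)
        = (1 - x.1 - x.2) * w 0 + x.1 * w 1 + x.2 * w 2 := fun w => by ring
    simp only [e]
    by_cases hx : (y, z) ∈ slab x.1 x.2 ×ˢ slab x.1 x.2
    · have hx' : ((1 - x.1 - x.2) * y 0 + x.1 * y 1 + x.2 * y 2,
          (1 - x.1 - x.2) * z 0 + x.1 * z 1 + x.2 * z 2)
          ∈ Set.Icc (0:ℝ) 1 ×ˢ Set.Icc (0:ℝ) 1 := hx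
      rw [Set.indicator_of_mem hx, Set.indicator_of_mem hx']
      simp only
      rw [cof_cons, headMean_smul hJ, ← mul_assoc, ← ENNReal.ofReal_mul (abs_nonneg _), mul_comm]
      congr 2
      exact abs_mul_abs_self _ |>.trans (sq _).symm
    · have hx' : ((1 - x.1 - x.2) * y 0 + x.1 * y 1 + x.2 * y 2,
          (1 - x.1 - x.2) * z 0 + x.1 * z 1 + x.2 * z 2)
          ∉ Set.Icc (0:ℝ) 1 ×ˢ Set.Icc (0:ℝ) 1 := hx
      rw [Set.indicator_of_notMem hx, Set.indicator_of_notMem hx', mul_zero, mul_zero]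

lemma lintegral_unifCube_succ {n : ℕ} {f : (Fin (n + 1) → ℝ) → ENNReal} (hf : Measurable f) :
    ∫⁻ y, f y ∂unifCube (n + 1) = ∫⁻ y, ∫⁻ s, f (Fin.cons s y) ∂unif ∂unifCube n := by
  have h := measurePreserving_cons unif n
  rw [unifCube, ← h.lintegral_comp hf]
  exact lintegral_prod_symm _ (hf.comp h.measurable).aemeasurable

lemma lintegral_lintegral_unifCube_succ {n : ℕ}
    {F : (Fin (n + 1) → ℝ) × (Fin (n + 1) → ℝ) → ENNReal} (hF : Measurable F) :
    ∫⁻ Y, ∫⁻ Z, F (Y, Z) ∂unifCube (n + 1) ∂unifCube (n + 1)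
      = ∫⁻ y, ∫⁻ z, ∫⁻ s, ∫⁻ t, F (Fin.cons s y, Fin.cons t z) ∂unif ∂unif
        ∂unifCube n ∂unifCube n := by
  have hcons := (measurePreserving_cons unif n).measurable
  rw [lintegral_unifCube_succ hF.lintegral_prod_right']
  refine lintegral_congr fun y => ?_
  have h1 : ∀ s, ∫⁻ Z, F (Fin.cons s y, Z) ∂unifCube (n + 1)
      = ∫⁻ z, ∫⁻ t, F (Fin.cons s y, Fin.cons t z) ∂unif ∂unifCube n := fun s =>
    lintegral_unifCube_succ (hF.comp measurable_prodMk_left)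
  rw [lintegral_congr h1]
  refine lintegral_lintegral_swap (f := fun s z => ∫⁻ t, F (Fin.cons s y, Fin.cons t z) ∂unif) ?_
  have h2 : Measurable fun x : (ℝ × (Fin n → ℝ)) × ℝ => (x.1.1, y) := by fun_prop
  have h3 : Measurable fun x : (ℝ × (Fin n → ℝ)) × ℝ => (x.2, x.1.2) := by fun_prop
  exact (hF.comp ((hcons.comp h2).prodMk (hcons.comp h3))).lintegral_prod_right'.aemeasurable

lemma lintegral_headMean_cof :
    ∫⁻ Y, ∫⁻ Z, headMean (cof Y Z) ∂unifCube 4 ∂unifCube 4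
      = ∫⁻ x : ℝ × ℝ, headMean (bary x) * secMass x.1 x.2 := by
  set f : (Fin 3 → ℝ) × (Fin 3 → ℝ) → ENNReal :=
    fun w => ENNReal.ofReal (tri 0 1 2 w.1 w.2 ^ 2) with hf
  have hfm : Measurable f := by
    simp only [hf, tri]
    fun_prop
  have hind := measurable_slab_indicator hfm
  have hind1 := hind.lintegral_prod_right' (ν := unifCube 3)
  have hb := measurable_headMean.comp measurable_bary
  have hind2 : ∀ x : ℝ × ℝ, Measurable fun w : (Fin 3 → ℝ) × (Fin 3 → ℝ) =>
      (slab x.1 x.2 ×ˢ slab x.1 x.2).indicator f w := fun x =>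
    hfm.indicator ((measurableSet_slab _ _).prod (measurableSet_slab _ _))
  calc _ = ∫⁻ y, ∫⁻ z, (∫⁻ x : ℝ × ℝ, headMean (bary x) *
        (slab x.1 x.2 ×ˢ slab x.1 x.2).indicator f (y, z)) ∂unifCube 3 ∂unifCube 3 := by
        rw [lintegral_lintegral_unifCube_succ (F := fun x => headMean (cof x.1 x.2))
          (measurable_headMean.comp measurable_cof)]
        simp only [lintegral_headMean_cons]
        rfl
    _ = ∫⁻ y, (∫⁻ x : ℝ × ℝ, ∫⁻ z, headMean (bary x) *
        (slab x.1 x.2 ×ˢ slab x.1 x.2).indicator f (y, z) ∂unifCube 3) ∂unifCube 3 := by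
        refine lintegral_congr fun y => ?_
        refine lintegral_lintegral_swap (f := fun (z : Fin 3 → ℝ) (x : ℝ × ℝ) =>
          headMean (bary x) * (slab x.1 x.2 ×ˢ slab x.1 x.2).indicator f (y, z)) ?_
        have hg : Measurable fun u : (Fin 3 → ℝ) × (ℝ × ℝ) => ((u.2, y), u.1) := by fun_prop
        exact ((hb.comp measurable_snd).mul (hind.comp hg)).aemeasurable
    _ = ∫⁻ y, (∫⁻ x : ℝ × ℝ, headMean (bary x) * ∫⁻ z,
        (slab x.1 x.2 ×ˢ slab x.1 x.2).indicator f (y, z) ∂unifCube 3) ∂unifCube 3 := by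
        refine lintegral_congr fun y => lintegral_congr fun x => ?_
        exact lintegral_const_mul _ ((hind2 x).comp measurable_prodMk_left)
    _ = ∫⁻ x : ℝ × ℝ, ∫⁻ y, headMean (bary x) * (∫⁻ z,
        (slab x.1 x.2 ×ˢ slab x.1 x.2).indicator f (y, z) ∂unifCube 3) ∂unifCube 3 := by
        refine lintegral_lintegral_swap (f := fun (y : Fin 3 → ℝ) (x : ℝ × ℝ) =>
          headMean (bary x) * ∫⁻ z,
            (slab x.1 x.2 ×ˢ slab x.1 x.2).indicator f (y, z) ∂unifCube 3) ?_
        exact ((hb.comp measurable_snd).mul (hind1.comp measurable_swap)).aemeasurable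
    _ = _ := by
        refine lintegral_congr fun x => ?_
        rw [lintegral_const_mul _ (hind2 x).lintegral_prod_right', secMass_eq]
        rfl

lemma ae_ne_line : ∀ᵐ x : ℝ × ℝ, x.1 ≠ 1 ∧ x.2 ≠ 1 ∧ x.1 + x.2 ≠ 0 := by
  have h2 : ∀ᵐ x : ℝ × ℝ, x.2 ≠ 1 :=
    Measure.quasiMeasurePreserving_snd.ae (Measure.ae_ne volume 1)
  have h1 : ∀ᵐ x : ℝ × ℝ, x.1 ≠ 1 :=
    Measure.quasiMeasurePreserving_fst.ae (Measure.ae_ne volume 1)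
  filter_upwards [h1, h2, measurePreserving_shear.quasiMeasurePreserving.ae h2] with x a b c
  refine ⟨a, b, fun h => c ?_⟩
  linarith

lemma abs_bary_le_iff (x : ℝ × ℝ) :
    (∀ j, |bary x j| ≤ |bary x 0|) ↔ |1 - x.1 - x.2| ≤ 1 ∧ |x.1| ≤ 1 ∧ |x.2| ≤ 1 := by
  simp [Fin.forall_fin_succ, bary]

lemma headMean_bary {x : ℝ × ℝ} (hx : x.1 ≠ 1 ∧ x.2 ≠ 1 ∧ x.1 + x.2 ≠ 0) :
    headMean (bary x) = {x : ℝ × ℝ | x.1 ≤ 1 ∧ x.2 ≤ 1 ∧ 0 ≤ x.1 + x.2}.indicator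
      (fun x => meanLin (bary x)) x := by
  obtain ⟨hp, hq, hr⟩ := hx
  by_cases h : x.1 ≤ 1 ∧ x.2 ≤ 1 ∧ 0 ≤ x.1 + x.2
  · rw [Set.indicator_of_mem (by exact h)]
    obtain ⟨h1, h2, h3⟩ := h
    have h1 := h1.lt_of_ne hp
    have h2 := h2.lt_of_ne hq
    have h3 := h3.lt_of_ne' hr
    have e1 : |x.1| < 1 := abs_lt.2 ⟨by linarith, h1⟩
    have e2 : |x.2| < 1 := abs_lt.2 ⟨by linarith, h2⟩
    have e3 : |1 - x.1 - x.2| < 1 := abs_lt.2 ⟨by linarith, by linarith⟩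
    have h0 : isMax 0 (bary x) = 1 := if_pos ((abs_bary_le_iff x).2 ⟨e3.le, e1.le, e2.le⟩)
    have hne : ∀ k, |bary x k| < |bary x 0| → isMax k (bary x) = 0 := fun k hk =>
      if_neg fun h => (h 0).not_gt hk
    have g1 : isMax 1 (bary x) = 0 := hne 1 (by simpa [bary] using e3)
    have g2 : isMax 2 (bary x) = 0 := hne 2 (by simpa [bary] using e1)
    have g3 : isMax 3 (bary x) = 0 := hne 3 (by simpa [bary] using e2)
    rw [headMean, maxWeight, Fin.sum_univ_four, h0, g1, g2, g3]
    simp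
  · rw [Set.indicator_of_notMem (by exact h), headMean, maxWeight, isMax, if_neg, zero_mul,
      mul_zero]
    rw [abs_bary_le_iff]
    rintro ⟨h1, h2, h3⟩
    exact h ⟨(abs_le.1 h2).2, (abs_le.1 h3).2, by linarith [(abs_le.1 h1).2]⟩

lemma lintegral_meanLin_cof_eq :
    ∫⁻ Y, ∫⁻ Z, meanLin (cof Y Z) ∂unifCube 4 ∂unifCube 4
      = ENNReal.ofReal (4 * (3977 / 144000 - Real.pi ^ 2 / 1440)) := by
  have hT : MeasurableSet {x : ℝ × ℝ | x.1 ≤ 1 ∧ x.2 ≤ 1 ∧ 0 ≤ x.1 + x.2} := by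
    have h1 : MeasurableSet {x : ℝ × ℝ | x.1 ≤ 1} := measurableSet_le (by fun_prop) (by fun_prop)
    have h2 : MeasurableSet {x : ℝ × ℝ | x.2 ≤ 1} := measurableSet_le (by fun_prop) (by fun_prop)
    have h3 : MeasurableSet {x : ℝ × ℝ | 0 ≤ x.1 + x.2} :=
      measurableSet_le (by fun_prop) (by fun_prop)
    exact h1.inter (h2.inter h3)
  rw [lintegral_meanLin_cof, lintegral_headMean_cof, ENNReal.ofReal_mul (by norm_num),
    ← setLIntegral_density, ← lintegral_indicator hT]
  congr 1
  · simp
  refine lintegral_congr_ae (ae_ne_line.mono fun x hx => ?_)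
  simp only
  rw [headMean_bary hx]
  by_cases h : x ∈ {x : ℝ × ℝ | x.1 ≤ 1 ∧ x.2 ≤ 1 ∧ 0 ≤ x.1 + x.2}
  · rw [Set.indicator_of_mem h, Set.indicator_of_mem h]
    rfl
  · rw [Set.indicator_of_notMem h, Set.indicator_of_notMem h, zero_mul]

/-- The corner simplex of size `c`. -/
def corner (n : ℕ) (c : ℝ) : Set (Fin n → ℝ) := {y | (∀ i, 0 ≤ y i) ∧ ∑ i, y i ≤ c}

lemma measurableSet_corner_simplex (n : ℕ) (c : ℝ) : MeasurableSet (corner n c) := by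
  have h1 : MeasurableSet {y : Fin n → ℝ | ∀ i, 0 ≤ y i} := by
    rw [Set.ofPred_forall]
    exact MeasurableSet.iInter fun i => measurableSet_le (by fun_prop) (by fun_prop)
  have h2 : MeasurableSet {y : Fin n → ℝ | ∑ i, y i ≤ c} :=
    measurableSet_le (by fun_prop) (by fun_prop)
  exact h1.inter h2

lemma cons_mem_corner {n : ℕ} {c s : ℝ} {y : Fin n → ℝ} :
    (Fin.cons s y : Fin (n + 1) → ℝ) ∈ corner (n + 1) c ↔ 0 ≤ s ∧ y ∈ corner n (c - s) := by
  simp only [corner, Set.mem_ofPred_eq, Fin.forall_fin_succ, Fin.cons_zero, Fin.cons_succ,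
    Fin.sum_univ_succ, le_sub_iff_add_le']
  tauto

lemma corner_eq_empty {n : ℕ} {c : ℝ} (hc : c < 0) : corner n c = ∅ :=
  Set.eq_empty_of_forall_notMem fun _ h => hc.not_ge ((Finset.sum_nonneg fun i _ => h.1 i).trans h.2)

lemma volume_corner (n : ℕ) {c : ℝ} (hc : 0 ≤ c) :
    volume (corner n c) = ENNReal.ofReal (c ^ n / n.factorial) := by
  induction n generalizing c with
  | zero =>
    have : corner 0 c = Set.univ := by
      ext y
      simp [corner, hc]
    rw [this, volume_pi, Measure.pi_of_empty]
    simp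
  | succ n ih =>
    have h := measurePreserving_cons (volume : Measure ℝ) n
    have hm := measurableSet_corner_simplex (n + 1) c
    rw [volume_pi, ← h.measure_preimage hm.nullMeasurableSet, Measure.prod_apply (h.measurable hm),
      ← volume_pi]
    have e : ∀ s : ℝ, volume (Prod.mk s ⁻¹' ((fun x : ℝ × (Fin n → ℝ) =>
        (Fin.cons x.1 x.2 : Fin (n + 1) → ℝ)) ⁻¹' corner (n + 1) c))
        = (Set.Icc 0 c).indicator
          (fun s => ENNReal.ofReal ((c - s) ^ n / n.factorial)) s := by
      intro s
      have : Prod.mk s ⁻¹' ((fun x : ℝ × (Fin n → ℝ) =>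
          (Fin.cons x.1 x.2 : Fin (n + 1) → ℝ)) ⁻¹' corner (n + 1) c)
          = {y | 0 ≤ s ∧ y ∈ corner n (c - s)} := by
        ext y
        exact cons_mem_corner
      rw [this]
      by_cases hs : s ∈ Set.Icc 0 c
      · rw [Set.indicator_of_mem hs, ← ih (sub_nonneg.2 hs.2)]
        simp [hs.1]
      · rw [Set.indicator_of_notMem hs]
        by_cases hs0 : 0 ≤ s
        · rw [corner_eq_empty (sub_neg.2 (not_le.1 fun h => hs ⟨hs0, h⟩))]
          simp
        · simp [hs0]
    rw [lintegral_congr e, lintegral_indicator measurableSet_Icc,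
      ← ofReal_integral_eq_lintegral_ofReal]
    · congr 1
      rw [integral_Icc_eq_integral_Ioc, ← intervalIntegral.integral_of_le hc,
        intervalIntegral.integral_div,
        intervalIntegral.integral_comp_sub_left (fun s => s ^ n) c, integral_pow]
      rw [Nat.factorial_succ]
      push_cast
      field_simp
      simp
    · exact (Continuous.continuousOn (by fun_prop)).integrableOn_compact isCompact_Icc
    · filter_upwards [ae_restrict_mem measurableSet_Icc] with s hs
      have := sub_nonneg.2 hs.2
      positivity

lemma convexHull_range_eq_image_corner {E : Type*} [AddCommGroup E] [Module ℝ E] {n : ℕ}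
    (x : Fin (n + 1) → E) :
    convexHull ℝ (Set.range x)
      = (fun y => x 0 + ∑ i, y i • (x i.succ - x 0)) '' corner n 1 := by
  have h : Set.range x = Fintype.linearCombination ℝ x ''
      Set.range fun i j : Fin (n + 1) => if i = j then (1:ℝ) else 0 := by
    rw [← Set.range_comp]
    congr 1
    funext i
    simp [Fintype.linearCombination_apply]
  rw [h, ← LinearMap.image_convexHull, convexHull_basis_eq_stdSimplex]
  ext z
  constructor
  · rintro ⟨w, ⟨hw0, hw1⟩, rfl⟩
    rw [Fin.sum_univ_succ] at hw1
    refine ⟨fun i => w i.succ, ⟨fun i => hw0 _, by linarith [hw0 0]⟩, ?_⟩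
    rw [Fintype.linearCombination_apply, Fin.sum_univ_succ, eq_sub_of_add_eq hw1]
    simp only [smul_sub, Finset.sum_sub_distrib, ← Finset.sum_smul, sub_smul, one_smul]
    abel
  · rintro ⟨y, ⟨hy0, hy1⟩, rfl⟩
    refine ⟨Fin.cons (1 - ∑ i, y i) y, ⟨fun i => ?_, ?_⟩, ?_⟩
    · refine Fin.cases ?_ (fun i => ?_) i
      · simpa using hy1
      · simpa using hy0 i
    · simp [Fin.sum_univ_succ]
    · rw [Fintype.linearCombination_apply, Fin.sum_univ_succ]
      simp only [Fin.cons_zero, Fin.cons_succ, smul_sub, Finset.sum_sub_distrib,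
        ← Finset.sum_smul, sub_smul, one_smul]
      abel

lemma volume_convexHull_range {n : ℕ} (x : Fin (n + 1) → Fin n → ℝ) :
    volume (convexHull ℝ (Set.range x))
      = ENNReal.ofReal (|(Matrix.of fun i j => x j.succ i - x 0 i).det| / n.factorial) := by
  set M : Matrix (Fin n) (Fin n) ℝ := Matrix.of fun i j => x j.succ i - x 0 i with hM
  have h : (fun y : Fin n → ℝ => x 0 + ∑ i, y i • (x i.succ - x 0))
      = (fun z => x 0 + z) ∘ Matrix.toLin' M := by
    funext y i
    simp [Matrix.toLin'_apply, Matrix.mulVec, dotProduct, hM, mul_comm]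
  rw [convexHull_range_eq_image_corner, h, Set.image_comp, Set.image_add_left,
    measure_preimage_add, Measure.addHaar_image_linearMap, LinearMap.det_toLin',
    volume_corner n zero_le_one, ← ENNReal.ofReal_mul (abs_nonneg _), one_pow, mul_one_div]

lemma volume_convexHull_range_toLp {n : ℕ} (x : Fin (n + 1) → Fin n → ℝ) :
    volume (convexHull ℝ (Set.range fun k => WithLp.toLp 2 (x k)))
      = ENNReal.ofReal (|(Matrix.of fun i j => x j.succ i - x 0 i).det| / n.factorial) := by
  rw [← volume_convexHull_range, ← (EuclideanSpace.volume_preserving_symm_measurableEquiv_toLp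
    (Fin n)).symm.measure_preimage_equiv]
  congr 1
  have : (fun k => WithLp.toLp 2 (x k)) = (WithLp.linearEquiv 2 ℝ (Fin n → ℝ)).symm ∘ x := rfl
  rw [this, Set.range_comp]
  change _ ⁻¹' convexHull ℝ ((WithLp.linearEquiv 2 ℝ (Fin n → ℝ)).symm.toLinearMap '' _) = _
  rw [← LinearMap.image_convexHull]
  exact Set.preimage_image_eq _ (WithLp.linearEquiv 2 ℝ (Fin n → ℝ)).symm.injective

lemma volume_tetrahedron (a b c d : Fin 3 → ℝ) :
    (volume (convexHull ℝ {WithLp.toLp 2 a, WithLp.toLp 2 b, WithLp.toLp 2 c,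
      (WithLp.toLp 2 d : EuclideanSpace ℝ (Fin 3))})).toReal
      = |∑ i, cof (fun k => ![a, b, c, d] k 0) (fun k => ![a, b, c, d] k 1) i
        * ![a, b, c, d] i 2| / 6 := by
  have h : ({WithLp.toLp 2 a, WithLp.toLp 2 b, WithLp.toLp 2 c,
      (WithLp.toLp 2 d : EuclideanSpace ℝ (Fin 3))} : Set _)
      = Set.range fun k => WithLp.toLp 2 (![a, b, c, d] k) := by
    ext z
    simp [Fin.exists_fin_succ, eq_comm]
  rw [h, volume_convexHull_range_toLp, ENNReal.toReal_ofReal (by positivity)]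
  congr 2
  rw [Matrix.det_fin_three]
  simp [Fin.sum_univ_four, cof, tri]
  ring

lemma unifCube_eq_restrict (n : ℕ) :
    unifCube n = (volume : Measure (Fin n → ℝ)).restrict (Set.univ.pi fun _ => Set.Icc 0 1) := by
  rw [volume_pi, Measure.restrict_pi_pi]
  rfl

lemma setIntegral_euclidean_cube (n : ℕ) (f : EuclideanSpace ℝ (Fin n) → ℝ) :
    ∫ x in {x : EuclideanSpace ℝ (Fin n) | ∀ i, x i ∈ Set.Icc (0:ℝ) 1}, f x
      = ∫ y, f (WithLp.toLp 2 y) ∂unifCube n := by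
  rw [unifCube_eq_restrict, ← (PiLp.volume_preserving_toLp (Fin n)).setIntegral_preimage_emb
    (MeasurableEquiv.toLp 2 (Fin n → ℝ)).measurableEmbedding]
  congr 2
  ext y
  simp [Pi.le_def, forall_and]

lemma isCompact_cube (n : ℕ) : IsCompact (Set.univ.pi fun _ : Fin n => Set.Icc (0:ℝ) 1) :=
  isCompact_univ_pi fun _ => isCompact_Icc

lemma continuous_integral_unifCube {X : Type*} [TopologicalSpace X] [FirstCountableTopology X]
    [LocallyCompactSpace X] {n : ℕ} {f : X × (Fin n → ℝ) → ℝ} (hf : Continuous f) :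
    Continuous fun x => ∫ y, f (x, y) ∂unifCube n := by
  simp only [unifCube_eq_restrict]
  exact continuous_parametric_integral_of_continuous (f := fun x y => f (x, y)) hf
    (isCompact_cube n)

lemma ofReal_integral_unifCube {n : ℕ} {f : (Fin n → ℝ) → ℝ} (hf : Continuous f)
    (h0 : ∀ y, 0 ≤ f y) :
    ENNReal.ofReal (∫ y, f y ∂unifCube n) = ∫⁻ y, ENNReal.ofReal (f y) ∂unifCube n :=
  ofReal_integral_eq_lintegral_ofReal (integrable_unifCube_of_continuous hf) (ae_of_all _ h0)

lemma ofReal_integral_unifCube_four {n : ℕ} {f : (Fin 4 → Fin n → ℝ) → ℝ} (hf : Continuous f)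
    (h0 : ∀ y, 0 ≤ f y) :
    ENNReal.ofReal (∫ a, ∫ b, ∫ c, ∫ d, f ![a, b, c, d]
      ∂unifCube n ∂unifCube n ∂unifCube n ∂unifCube n)
      = ∫⁻ a, ∫⁻ b, ∫⁻ c, ∫⁻ d, ENNReal.ofReal (f ![a, b, c, d])
        ∂unifCube n ∂unifCube n ∂unifCube n ∂unifCube n := by
  have c4 : Continuous fun x : (((Fin n → ℝ) × (Fin n → ℝ)) × (Fin n → ℝ)) × (Fin n → ℝ) =>
      f ![x.1.1.1, x.1.1.2, x.1.2, x.2] := by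
    refine hf.comp (continuous_pi fun i => ?_)
    fin_cases i <;> simp <;> fun_prop
  have c3 := continuous_integral_unifCube c4
  have c2 := continuous_integral_unifCube c3
  have c1 := continuous_integral_unifCube c2
  rw [ofReal_integral_unifCube c1 fun _ => integral_nonneg fun _ => integral_nonneg fun _ =>
    integral_nonneg fun _ => h0 _]
  refine lintegral_congr fun a => ?_
  refine (ofReal_integral_unifCube (c2.comp (Continuous.prodMk_right a)) fun _ =>
    integral_nonneg fun _ => integral_nonneg fun _ => h0 _).trans (lintegral_congr fun b => ?_)
  refine (ofReal_integral_unifCube (c3.comp (Continuous.prodMk_right (a, b))) fun _ =>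
    integral_nonneg fun _ => h0 _).trans (lintegral_congr fun c => ?_)
  exact ofReal_integral_unifCube (c4.comp (Continuous.prodMk_right ((a, b), c))) fun _ => h0 _

lemma lintegral_pi_succ {α : Type*} [MeasurableSpace α] (μ : Measure α) [SigmaFinite μ] {n : ℕ}
    {f : (Fin (n + 1) → α) → ENNReal} (hf : Measurable f) :
    ∫⁻ y, f y ∂Measure.pi (fun _ => μ)
      = ∫⁻ s, ∫⁻ y, f (Fin.cons s y) ∂Measure.pi (fun _ => μ) ∂μ := by
  have h := measurePreserving_cons μ n
  rw [← h.lintegral_comp hf]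
  exact lintegral_prod _ (hf.comp h.measurable).aemeasurable

lemma lintegral_pi_four {α : Type*} [MeasurableSpace α] (μ : Measure α) [SigmaFinite μ]
    {f : (Fin 4 → α) → ENNReal} (hf : Measurable f) :
    ∫⁻ y, f y ∂Measure.pi (fun _ => μ) = ∫⁻ a, ∫⁻ b, ∫⁻ c, ∫⁻ d, f ![a, b, c, d] ∂μ ∂μ ∂μ ∂μ := by
  have hc : ∀ (n : ℕ) (s : α), Measurable fun y : Fin n → α => (Fin.cons s y : Fin (n + 1) → α) :=
    fun n s => (measurePreserving_cons μ n).measurable.comp measurable_prodMk_left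
  rw [lintegral_pi_succ μ hf]
  refine lintegral_congr fun a => ?_
  have h3 := hf.comp (hc 3 a)
  refine (lintegral_pi_succ μ h3).trans (lintegral_congr fun b => ?_)
  have h2 := h3.comp (hc 2 b)
  refine (lintegral_pi_succ μ h2).trans (lintegral_congr fun c => ?_)
  have h1 := h2.comp (hc 1 c)
  refine (lintegral_pi_succ μ h1).trans (lintegral_congr fun d => ?_)
  rw [Measure.pi_of_empty _ ![], lintegral_dirac]
  rfl

/-- Independent uniform points have independent uniform coordinates. -/
lemma lintegral_unifCube_three_transpose {m : ℕ} {f : (Fin m → Fin 3 → ℝ) → ENNReal}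
    (hf : Measurable f) :
    ∫⁻ x, f x ∂Measure.pi (fun _ => unifCube 3)
      = ∫⁻ Y, ∫⁻ Z, ∫⁻ X, f (fun k => ![Y k, Z k, X k]) ∂unifCube m ∂unifCube m ∂unifCube m := by
  have h1 := measurePreserving_pi (fun _ : Fin m => unif.prod (unif.prod unif))
    (fun _ => unifCube 3) fun _ => measurePreserving_vec3 unif
  have h2 := (measurePreserving_arrowProdEquivProdArrow ℝ (ℝ × ℝ) (Fin m) (fun _ => unif)
    fun _ => unif.prod unif).symm
  have h3 := ((MeasurePreserving.id (unifCube m)).prod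
    (measurePreserving_arrowProdEquivProdArrow ℝ ℝ (Fin m) (fun _ => unif) fun _ => unif).symm)
  have h := h1.comp (h2.comp h3)
  rw [← h.lintegral_comp hf]
  refine (lintegral_prod _ (hf.comp h.measurable).aemeasurable).trans
    (lintegral_congr fun Y => ?_)
  exact lintegral_prod _ ((hf.comp h.measurable).comp measurable_prodMk_left).aemeasurable

/-- The expected volume of the tetrahedron spanned by four i.i.d. uniform random points
in the unit cube equals `3977/216000 − π²/2160`. -/
theorem stmt_8 :
    (∫ x₀ in {x : EuclideanSpace ℝ (Fin 3) | ∀ i, x i ∈ Set.Icc (0:ℝ) 1},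
        ∫ x₁ in {x : EuclideanSpace ℝ (Fin 3) | ∀ i, x i ∈ Set.Icc (0:ℝ) 1},
          ∫ x₂ in {x : EuclideanSpace ℝ (Fin 3) | ∀ i, x i ∈ Set.Icc (0:ℝ) 1},
            ∫ x₃ in {x : EuclideanSpace ℝ (Fin 3) | ∀ i, x i ∈ Set.Icc (0:ℝ) 1},
              (volume (convexHull ℝ {x₀, x₁, x₂, x₃})).toReal)
      = 3977 / 216000 - Real.pi ^ 2 / 2160 := by
  set f : (Fin 4 → Fin 3 → ℝ) → ℝ := fun x =>
    |∑ i, cof (fun k => x k 0) (fun k => x k 1) i * x i 2| / 6 with hf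
  have hfc : Continuous f := by
    simp only [hf, Fin.sum_univ_four, cof, tri, Matrix.cons_val_zero, Matrix.cons_val_one,
      Matrix.cons_val]
    fun_prop
  have hf0 : ∀ x, 0 ≤ f x := fun x => by positivity
  have hpi : Real.pi ^ 2 ≤ 16 := by nlinarith [Real.pi_pos, Real.pi_le_four]
  simp only [setIntegral_euclidean_cube, volume_tetrahedron]
  refine (ENNReal.ofReal_eq_ofReal_iff (integral_nonneg fun _ => integral_nonneg fun _ =>
    integral_nonneg fun _ => integral_nonneg fun _ => by positivity) (by linarith)).1 ?_
  refine (ofReal_integral_unifCube_four hfc hf0).trans ?_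
  rw [← lintegral_pi_four (unifCube 3) hfc.measurable.ennreal_ofReal,
    lintegral_unifCube_three_transpose hfc.measurable.ennreal_ofReal]
  have e : ∀ Y Z, ∫⁻ X, ENNReal.ofReal (f fun k => ![Y k, Z k, X k]) ∂unifCube 4
      = ENNReal.ofReal (1 / 6) * meanLin (cof Y Z) := by
    intro Y Z
    rw [meanLin, ← lintegral_const_mul' _ _ ENNReal.ofReal_ne_top]
    refine lintegral_congr fun X => ?_
    rw [← ENNReal.ofReal_mul (by norm_num), mul_comm, mul_one_div]
    rfl
  simp only [e, lintegral_const_mul' _ _ ENNReal.ofReal_ne_top]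
  rw [lintegral_meanLin_cof_eq, ← ENNReal.ofReal_mul (by norm_num)]
  congr 1
  ring
end

section
/- The second moment of the volume of a random tetrahedron in a tetrahedron of volume 1 equals 3/4000, and in the unit cube equals 1/2592. -/
open MeasureTheory

/-- An antiderivative of `(t - y) ^ k`. -/
theorem hasDerivAt_neg_sub_pow_div (k : ℕ) (t x : ℝ) :
    HasDerivAt (fun y : ℝ => -((t - y) ^ (k + 1) / (k + 1))) ((t - x) ^ k) x := by
  refine ((((hasDerivAt_id' x).const_sub t).pow (k + 1)).div_const (k + 1 : ℝ)).neg.congr_deriv ?_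
  push_cast
  field_simp

/-- The beta integral `B(b + 1, k + 1)` rescaled to the interval `[0, t]`. -/
theorem integral_pow_mul_sub_pow (b : ℕ) : ∀ (k : ℕ) (t : ℝ),
    ∫ y in (0:ℝ)..t, y ^ b * (t - y) ^ k
      = (b.factorial * k.factorial / (b + k + 1).factorial : ℝ) * t ^ (b + k + 1) := by
  induction b with
  | zero =>
    intro k t
    have h : ∀ x ∈ Set.uIcc 0 t,
        HasDerivAt (fun y : ℝ => -((t - y) ^ (k + 1) / (k + 1))) (x ^ 0 * (t - x) ^ k) x := by
      intro x _
      simpa using hasDerivAt_neg_sub_pow_div k t x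
    rw [intervalIntegral.integral_eq_sub_of_hasDerivAt h
      (Continuous.intervalIntegrable (by fun_prop) _ _)]
    have := Nat.factorial_pos k
    simp [Nat.factorial_succ]
    field_simp
  | succ b ih =>
    intro k t
    have h := intervalIntegral.integral_mul_deriv_eq_deriv_mul
      (a := 0) (b := t) (u := fun y : ℝ => y ^ (b + 1)) (u' := fun y => (b + 1 : ℝ) * y ^ b)
      (v := fun y : ℝ => -((t - y) ^ (k + 1) / (k + 1))) (v' := fun y => (t - y) ^ k)
      (by intro x _; simpa using hasDerivAt_pow (b + 1) x)
      (fun x _ => hasDerivAt_neg_sub_pow_div k t x)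
      (Continuous.intervalIntegrable (by fun_prop) _ _)
      (Continuous.intervalIntegrable (by fun_prop) _ _)
    rw [h]
    have h2 : ∀ y : ℝ, (b + 1 : ℝ) * y ^ b * -((t - y) ^ (k + 1) / (k + 1))
        = (-(b + 1) / (k + 1) : ℝ) * (y ^ b * (t - y) ^ (k + 1)) := by
      intro y; ring
    simp only [h2, intervalIntegral.integral_const_mul, ih]
    rw [show b + (k + 1) + 1 = b + 1 + k + 1 by ring]
    simp [Nat.factorial_succ b, Nat.factorial_succ k]
    field_simp
    ring

/-- The corner simplex `{x ≥ 0, ∑ x ≤ t}`. -/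
def cornerSimplex (n : ℕ) (t : ℝ) : Set (Fin n → ℝ) :=
  {x | (∀ i, 0 ≤ x i) ∧ ∑ i, x i ≤ t}

theorem isClosed_cornerSimplex (n : ℕ) (t : ℝ) : IsClosed (cornerSimplex n t) := by
  refine IsClosed.inter (s₁ := {x : Fin n → ℝ | ∀ i, 0 ≤ x i})
    (s₂ := {x : Fin n → ℝ | ∑ i, x i ≤ t}) ?_ (isClosed_le (by fun_prop) (by fun_prop))
  simp only [Set.ofPred_forall]
  exact isClosed_iInter fun i => isClosed_le (by fun_prop) (by fun_prop)

theorem isCompact_cornerSimplex (n : ℕ) (t : ℝ) : IsCompact (cornerSimplex n t) := by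
  refine (isCompact_univ_pi fun _ : Fin n => isCompact_Icc (a := (0:ℝ)) (b := t)).of_isClosed_subset
    (isClosed_cornerSimplex n t) ?_
  rintro x ⟨h0, h1⟩ i -
  exact ⟨h0 i, (Finset.single_le_sum (fun j _ => h0 j) (Finset.mem_univ i)).trans h1⟩

theorem cons_mem_cornerSimplex {n : ℕ} {t x : ℝ} {y : Fin n → ℝ} :
    Fin.cons (α := fun _ => ℝ) x y ∈ cornerSimplex (n + 1) t ↔
      0 ≤ x ∧ y ∈ cornerSimplex n (t - x) := by
  simp [cornerSimplex, Fin.forall_fin_succ, Fin.sum_univ_succ, le_sub_iff_add_le, and_assoc,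
    add_comm]

theorem cornerSimplex_eq_empty {n : ℕ} {t : ℝ} (ht : t < 0) : cornerSimplex n t = ∅ := by
  ext x
  simp only [cornerSimplex, Set.mem_ofPred_eq, Set.mem_empty_iff_false, iff_false, not_and, not_le]
  exact fun h => ht.trans_le (Finset.sum_nonneg fun i _ => h i)

/-- Dirichlet's formula for the monomial moments of the corner simplex. -/
theorem setIntegral_cornerSimplex_prod_pow (n : ℕ) : ∀ (a : Fin n → ℕ) {t : ℝ}, 0 ≤ t →
    ∫ x in cornerSimplex n t, ∏ i, x i ^ a i
      = ((∏ i, (a i).factorial : ℕ) / (n + ∑ i, a i).factorial : ℝ) * t ^ (n + ∑ i, a i) := by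
  induction n with
  | zero =>
    intro a t ht
    have : cornerSimplex 0 t = Set.univ := by
      ext x; simp [cornerSimplex, ht]
    simp [this, measureReal_def, volume_pi]
  | succ n ih =>
    intro a t ht
    set e := MeasurableEquiv.piFinSuccAbove (fun _ : Fin (n + 1) => ℝ) 0
    have he := (volume_preserving_piFinSuccAbove (fun _ : Fin (n + 1) => ℝ) 0).symm
    have hS := (isClosed_cornerSimplex (n + 1) t).measurableSet
    set f : (Fin (n + 1) → ℝ) → ℝ :=
      (cornerSimplex (n + 1) t).indicator fun x => ∏ i, x i ^ a i
    have hint : Integrable f := by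
      refine IntegrableOn.integrable_indicator ?_ hS
      exact (Continuous.continuousOn (by fun_prop)).integrableOn_compact
        (isCompact_cornerSimplex _ _)
    rw [← integral_indicator hS]
    change ∫ x, f x = _
    rw [← he.integral_comp e.symm.measurableEmbedding f]
    have hint2 : Integrable (fun p => f (e.symm p)) :=
      (he.integrable_comp_emb e.symm.measurableEmbedding).2 hint
    rw [Measure.volume_eq_prod] at hint2 ⊢
    rw [integral_prod _ hint2]
    have hinner : ∀ x : ℝ, ∫ y : Fin n → ℝ, f (e.symm (x, y))
        = (Set.Icc 0 t).indicator (fun x => x ^ a 0 *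
          (((∏ i : Fin n, (a i.succ).factorial : ℕ) / (n + ∑ i : Fin n, a i.succ).factorial : ℝ) *
            (t - x) ^ (n + ∑ i : Fin n, a i.succ))) x := by
      intro x
      have hf : ∀ y : Fin n → ℝ, f (e.symm (x, y)) = (if 0 ≤ x then x ^ a 0 else 0) *
          (cornerSimplex n (t - x)).indicator (fun y => ∏ i, y i ^ a i.succ) y := by
        intro y
        classical
        have : e.symm (x, y) = Fin.cons (α := fun _ => ℝ) x y := Fin.insertNth_zero' x y
        rw [this]
        simp only [f, Set.indicator_apply, cons_mem_cornerSimplex]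
        by_cases h0 : 0 ≤ x <;> by_cases h1 : y ∈ cornerSimplex n (t - x) <;>
          simp [h0, h1, Fin.prod_univ_succ]
      simp only [hf]
      rw [integral_const_mul, integral_indicator (isClosed_cornerSimplex _ _).measurableSet]
      by_cases h0 : 0 ≤ x
      · by_cases h1 : x ≤ t
        · rw [ih _ (sub_nonneg.2 h1)]
          simp [h0, h1]
        · rw [cornerSimplex_eq_empty (by linarith)]
          simp [h1]
      · simp [h0]
    simp only [hinner]
    rw [integral_indicator measurableSet_Icc, integral_Icc_eq_integral_Ioc,
      ← intervalIntegral.integral_of_le ht]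
    simp only [mul_left_comm (_ ^ a 0)]
    rw [intervalIntegral.integral_const_mul, integral_pow_mul_sub_pow]
    rw [Fin.prod_univ_succ, Fin.sum_univ_succ,
      show a 0 + (n + ∑ i : Fin n, a i.succ) + 1 = n + 1 + (a 0 + ∑ i : Fin n, a i.succ) by ring]
    have := Nat.factorial_pos (n + ∑ i : Fin n, a i.succ)
    push_cast
    field_simp

theorem setIntegral_unitCube_prod_pow (n : ℕ) (a : Fin n → ℕ) :
    ∫ x in Set.univ.pi fun _ : Fin n => Set.Icc (0:ℝ) 1, ∏ i, x i ^ a i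
      = ∏ i, (1 / (a i + 1) : ℝ) := by
  rw [volume_pi, Measure.restrict_pi_pi, integral_fintype_prod_eq_prod (fun i x => x ^ a i)]
  refine Finset.prod_congr rfl fun i _ => ?_
  rw [integral_Icc_eq_integral_Ioc, ← intervalIntegral.integral_of_le zero_le_one, integral_pow]
  simp

/-- Andréief's identity for four i.i.d. points: the second moment of a random determinant is
`4!` times the determinant of the moment matrix. -/
theorem integral_det_sq {E : Type*} [MeasurableSpace E] (μ : Measure E) (f : Fin 4 → E → ℝ)
    (hf : ∀ i j, Integrable (fun x => f i x * f j x) μ) :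
    ∫ x₀, ∫ x₁, ∫ x₂, ∫ x₃,
        (Matrix.of fun i j => f i (![x₀, x₁, x₂, x₃] j)).det ^ 2 ∂μ ∂μ ∂μ ∂μ
      = 24 * (Matrix.of fun i j => ∫ x, f i x * f j x ∂μ).det := by
  set M : Matrix (Fin 4) (Fin 4) ℝ := Matrix.of fun i j => ∫ x, f i x * f j x ∂μ with hM
  let s (σ : Equiv.Perm (Fin 4)) : ℝ := ((Equiv.Perm.sign σ : ℤ) : ℝ)
  let g (p : Equiv.Perm (Fin 4) × Equiv.Perm (Fin 4)) (j : Fin 4) (x : E) : ℝ :=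
    f (p.1 j) x * f (p.2 j) x
  have hg (p) (j) : Integrable (g p j) μ := hf _ _
  have hgM (p) (j) : ∫ x, g p j x ∂μ = M (p.1 j) (p.2 j) := rfl
  have hexp : ∀ x₀ x₁ x₂ x₃ : E, (Matrix.of fun i j => f i (![x₀, x₁, x₂, x₃] j)).det ^ 2
      = ∑ p, s p.1 * s p.2 * g p 0 x₀ * g p 1 x₁ * g p 2 x₂ * g p 3 x₃ := by
    intro x₀ x₁ x₂ x₃
    rw [Matrix.det_apply', sq, Finset.sum_mul_sum, ← Finset.sum_product']
    refine Finset.sum_congr rfl fun p _ => ?_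
    simp [Fin.prod_univ_four, s, g]
    ring
  simp only [hexp]
  have hint (c : Equiv.Perm (Fin 4) × Equiv.Perm (Fin 4) → ℝ) (j : Fin 4) :
      ∫ x, ∑ p, c p * g p j x ∂μ = ∑ p, c p * M (p.1 j) (p.2 j) := by
    rw [integral_finsetSum _ fun p _ => (hg p j).const_mul (c p)]
    exact Finset.sum_congr rfl fun p _ => integral_const_mul _ _
  simp only [hint, mul_right_comm _ (g _ 2 _) (M _ _), mul_right_comm _ (g _ 1 _) (M _ _),
    mul_right_comm _ (g _ 0 _) (M _ _)]
  rw [Fintype.sum_prod_type]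
  have hrow (σ : Equiv.Perm (Fin 4)) :
      ∑ τ, s σ * s τ * M (σ 3) (τ 3) * M (σ 2) (τ 2) * M (σ 1) (τ 1) * M (σ 0) (τ 0) = M.det := by
    have hs : s σ * s σ = 1 := by
      simp only [s, ← Int.cast_mul, Int.units_coe_mul_self, Int.cast_one]
    have hdet : (M.submatrix σ id).det = s σ * M.det := Matrix.det_permute σ M
    rw [← one_mul M.det, ← hs, mul_assoc, ← hdet, ← Matrix.det_transpose, Matrix.det_apply',
      Finset.mul_sum]
    refine Finset.sum_congr rfl fun τ _ => ?_
    simp [Fin.prod_univ_four, s]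
    ring
  simp [hrow, Fintype.card_perm, Nat.factorial]

section AffineImage

variable {E : Type*} [NormedAddCommGroup E] [NormedSpace ℝ E] [FiniteDimensional ℝ E]
  [MeasurableSpace E] [BorelSpace E] (μ : Measure E) [μ.IsAddHaarMeasure]

theorem addHaar_image_affineMap (φ : E →ᵃ[ℝ] E) (s : Set E) :
    μ (φ '' s) = ENNReal.ofReal |LinearMap.det φ.linear| * μ s := by
  have h : φ '' s = (fun x => φ 0 + x) '' (φ.linear '' s) := by
    rw [Set.image_image]
    refine Set.image_congr fun x _ => ?_
    rw [φ.decomp]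
    simp [add_comm]
  rw [h, Set.image_add_left, measure_preimage_add, Measure.addHaar_image_linearMap]

theorem setIntegral_image_affineMap {φ : E →ᵃ[ℝ] E} (hφ : LinearMap.det φ.linear ≠ 0) {s : Set E}
    (hs : MeasurableSet s) (g : E → ℝ) :
    ∫ x in φ '' s, g x ∂μ = |LinearMap.det φ.linear| * ∫ x in s, g (φ x) ∂μ := by
  have hinj : Function.Injective φ :=
    φ.linear_injective_iff.1 ((LinearMap.equivOfDetNeZero φ.linear hφ).injective)
  have hderiv (x : E) : HasFDerivAt φ (LinearMap.toContinuousLinearMap φ.linear) x := by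
    rw [φ.decomp]
    exact (LinearMap.toContinuousLinearMap φ.linear).hasFDerivAt.add_const _
  rw [integral_image_eq_integral_abs_det_fderiv_smul μ hs
    (fun x _ => (hderiv x).hasFDerivWithinAt) hinj.injOn]
  simp only [smul_eq_mul, integral_const_mul]
  simp [ContinuousLinearMap.det]

end AffineImage

/-- The (unnormalised) second moment of the volume of the simplex spanned by four independent
uniform points of `K`. -/
noncomputable def simplexSecondMoment (K : Set (EuclideanSpace ℝ (Fin 3))) : ℝ :=
  ∫ x₀ in K, ∫ x₁ in K, ∫ x₂ in K, ∫ x₃ in K, (volume (convexHull ℝ {x₀, x₁, x₂, x₃})).toReal ^ 2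

theorem simplexSecondMoment_image
    {φ : EuclideanSpace ℝ (Fin 3) →ᵃ[ℝ] EuclideanSpace ℝ (Fin 3)}
    (hφ : LinearMap.det φ.linear ≠ 0) {K : Set (EuclideanSpace ℝ (Fin 3))}
    (hK : MeasurableSet K) :
    simplexSecondMoment (φ '' K) = |LinearMap.det φ.linear| ^ 6 * simplexSecondMoment K := by
  have h (x₀ x₁ x₂ x₃ : EuclideanSpace ℝ (Fin 3)) :
      (volume (convexHull ℝ {φ x₀, φ x₁, φ x₂, φ x₃})).toReal ^ 2
        = |LinearMap.det φ.linear| ^ 2 * (volume (convexHull ℝ {x₀, x₁, x₂, x₃})).toReal ^ 2 := by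
    rw [← Set.image_singleton, ← Set.image_insert_eq, ← Set.image_insert_eq,
      ← Set.image_insert_eq, ← AffineMap.image_convexHull, addHaar_image_affineMap,
      ENNReal.toReal_mul, ENNReal.toReal_ofReal (abs_nonneg _), mul_pow]
  simp only [simplexSecondMoment, setIntegral_image_affineMap volume hφ hK, h, integral_const_mul]
  ring

/-- The convex hull of the origin and the standard basis vectors. -/
def cornerTetrahedron : Set (EuclideanSpace ℝ (Fin 3)) :=
  WithLp.ofLp ⁻¹' cornerSimplex 3 1

theorem measurableSet_cornerTetrahedron : MeasurableSet cornerTetrahedron :=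
  ((isClosed_cornerSimplex 3 1).preimage (PiLp.continuous_ofLp 2 _)).measurableSet

theorem cornerTetrahedron_eq_convexHull :
    cornerTetrahedron = convexHull ℝ {0, EuclideanSpace.single 0 1, EuclideanSpace.single 1 1,
      EuclideanSpace.single 2 1} := by
  refine Set.Subset.antisymm (fun x hx => ?_) (convexHull_min ?_ ?_)
  · obtain ⟨h0, h1⟩ := hx
    simp only [Fin.sum_univ_three] at h1
    refine mem_convexHull_of_exists_fintype ![1 - x 0 - x 1 - x 2, x 0, x 1, x 2]
      ![0, EuclideanSpace.single 0 1, EuclideanSpace.single 1 1, EuclideanSpace.single 2 1]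
      ?_ ?_ ?_ ?_
    · simp only [Fin.forall_fin_succ]
      refine ⟨?_, h0 0, h0 1, h0 2, fun i => i.elim0⟩
      simp
      linarith
    · simp [Fin.sum_univ_four]
      ring
    · simp [Fin.forall_fin_succ]
    · ext i
      fin_cases i <;> simp [Fin.sum_univ_four]
  · simp [Set.insert_subset_iff, cornerTetrahedron, cornerSimplex, Fin.forall_fin_succ,
      Fin.sum_univ_three]
  · refine Convex.is_linear_preimage (f := WithLp.ofLp) ?_ ⟨fun _ _ => rfl, fun _ _ => rfl⟩
    rintro x ⟨hx0, hx1⟩ y ⟨hy0, hy1⟩ a b ha hb hab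
    refine ⟨fun i => ?_, ?_⟩
    · have := hx0 i
      have := hy0 i
      simp only [Pi.add_apply, Pi.smul_apply, smul_eq_mul]
      positivity
    · simp only [Pi.add_apply, Pi.smul_apply, smul_eq_mul, Finset.sum_add_distrib,
        ← Finset.mul_sum]
      nlinarith

/-- The affine map sending the vertices of the corner tetrahedron to the given points. -/
noncomputable def tetrahedronMap (A B C D : EuclideanSpace ℝ (Fin 3)) :
    EuclideanSpace ℝ (Fin 3) →ᵃ[ℝ] EuclideanSpace ℝ (Fin 3) :=
  (Matrix.toEuclideanLin (Matrix.of fun i j => ![B - A, C - A, D - A] j i)).toAffineMap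
    + AffineMap.const ℝ _ A

theorem det_tetrahedronMap (A B C D : EuclideanSpace ℝ (Fin 3)) :
    LinearMap.det (tetrahedronMap A B C D).linear
      = (Matrix.of fun i j => ![B - A, C - A, D - A] j i).det := by
  rw [← LinearMap.det_toLin (EuclideanSpace.basisFun (Fin 3) ℝ).toBasis,
    ← Matrix.toEuclideanLin_eq_toLin_orthonormal]
  simp [tetrahedronMap]

theorem tetrahedronMap_image (A B C D : EuclideanSpace ℝ (Fin 3)) :
    tetrahedronMap A B C D '' cornerTetrahedron = convexHull ℝ {A, B, C, D} := by
  rw [cornerTetrahedron_eq_convexHull, AffineMap.image_convexHull]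
  have h (k : Fin 3) :
      tetrahedronMap A B C D (EuclideanSpace.single k 1) = ![B - A, C - A, D - A] k + A := by
    ext i
    simp [tetrahedronMap, Matrix.toLpLin_apply]
  simp only [Set.image_insert_eq, Set.image_singleton, h]
  simp [tetrahedronMap]

/-- Homogeneous coordinates `(1, x₀, x₁, x₂)`. -/
def homogeneousCoord (i : Fin 4) (x : Fin 3 → ℝ) : ℝ :=
  ∏ k, x k ^ (if i = k.succ then 1 else 0)

theorem homogeneousCoord_mul (i j : Fin 4) (x : Fin 3 → ℝ) :
    homogeneousCoord i x * homogeneousCoord j x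
      = ∏ k, x k ^ ((if i = k.succ then 1 else 0) + (if j = k.succ then 1 else 0)) := by
  simp only [homogeneousCoord, pow_add, Finset.prod_mul_distrib]

theorem volume_cornerTetrahedron : (volume cornerTetrahedron).toReal = 1 / 6 := by
  rw [cornerTetrahedron, (PiLp.volume_preserving_ofLp (Fin 3)).measure_preimage
    (isClosed_cornerSimplex 3 1).measurableSet.nullMeasurableSet]
  have := setIntegral_cornerSimplex_prod_pow 3 0 zero_le_one
  simpa [measureReal_def, Nat.factorial] using this

theorem volume_convexHull_tetrahedron (A B C D : EuclideanSpace ℝ (Fin 3)) :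
    (volume (convexHull ℝ {A, B, C, D})).toReal
      = |LinearMap.det (tetrahedronMap A B C D).linear| / 6 := by
  rw [← tetrahedronMap_image, addHaar_image_affineMap, ENNReal.toReal_mul,
    ENNReal.toReal_ofReal (abs_nonneg _), volume_cornerTetrahedron]
  ring

theorem volume_convexHull_tetrahedron_sq (A B C D : EuclideanSpace ℝ (Fin 3)) :
    (volume (convexHull ℝ {A, B, C, D})).toReal ^ 2
      = 1 / 36 * (Matrix.of fun i j => homogeneousCoord i (![A, B, C, D] j).ofLp).det ^ 2 := by
  have h : LinearMap.det (tetrahedronMap A B C D).linear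
      = (Matrix.of fun i j => homogeneousCoord i (![A, B, C, D] j).ofLp).det := by
    rw [det_tetrahedronMap]
    simp [Matrix.det_succ_row_zero, Fin.sum_univ_succ, homogeneousCoord, Fin.prod_univ_succ,
      Fin.succAbove, Fin.ext_iff]
    ring
  rw [volume_convexHull_tetrahedron, h, div_pow, sq_abs]
  ring

theorem simplexSecondMoment_preimage_ofLp {K : Set (Fin 3 → ℝ)} (hK : IsCompact K) :
    simplexSecondMoment (WithLp.ofLp ⁻¹' K)
      = 2 / 3 * (Matrix.of fun i j : Fin 4 => ∫ x in K, ∏ k, x k ^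
          ((if i = k.succ then 1 else 0) + (if j = k.succ then 1 else 0))).det := by
  have hmp := PiLp.volume_preserving_ofLp (Fin 3)
  have hemb : MeasurableEmbedding (WithLp.ofLp : EuclideanSpace ℝ (Fin 3) → Fin 3 → ℝ) :=
    (MeasurableEquiv.toLp 2 (Fin 3 → ℝ)).symm.measurableEmbedding
  have hint (i j : Fin 4) : Integrable (fun x : EuclideanSpace ℝ (Fin 3) =>
      homogeneousCoord i x.ofLp * homogeneousCoord j x.ofLp)
      (volume.restrict (WithLp.ofLp ⁻¹' K)) := by
    have h : IntegrableOn (fun x => homogeneousCoord i x * homogeneousCoord j x) K := by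
      refine ContinuousOn.integrableOn_compact hK (Continuous.continuousOn ?_)
      unfold homogeneousCoord
      fun_prop
    exact (hmp.integrableOn_comp_preimage hemb).2 h
  simp only [simplexSecondMoment, volume_convexHull_tetrahedron_sq, integral_const_mul]
  have key := integral_det_sq _
    (fun i (x : EuclideanSpace ℝ (Fin 3)) => homogeneousCoord i x.ofLp) hint
  have hmoment (i j : Fin 4) :
      ∫ x : EuclideanSpace ℝ (Fin 3) in WithLp.ofLp ⁻¹' K,
          homogeneousCoord i x.ofLp * homogeneousCoord j x.ofLp
        = ∫ x in K, ∏ k, x k ^ ((if i = k.succ then 1 else 0) + (if j = k.succ then 1 else 0)) := by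
    simp only [← homogeneousCoord_mul]
    exact hmp.setIntegral_preimage_emb hemb
      (fun x => homogeneousCoord i x * homogeneousCoord j x) K
  simp only [hmoment] at key
  rw [key, ← mul_assoc]
  norm_num

theorem simplexSecondMoment_cornerTetrahedron :
    simplexSecondMoment cornerTetrahedron = 1 / 6 ^ 6 * (3 / 4000) := by
  rw [cornerTetrahedron, simplexSecondMoment_preimage_ofLp (isCompact_cornerSimplex 3 1)]
  simp only [setIntegral_cornerSimplex_prod_pow 3 _ zero_le_one]
  trans 2 / 3 * Matrix.det (R := ℝ)
    !![1 / 6, 1 / 24, 1 / 24, 1 / 24; 1 / 24, 1 / 60, 1 / 120, 1 / 120;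
      1 / 24, 1 / 120, 1 / 60, 1 / 120; 1 / 24, 1 / 120, 1 / 120, 1 / 60]
  · congr 2
    ext i j
    fin_cases i <;> fin_cases j <;>
      norm_num [Fin.sum_univ_three, Fin.prod_univ_three, Nat.factorial, Fin.ext_iff]
  · simp [Matrix.det_succ_row_zero, Fin.sum_univ_succ, Fin.succAbove]
    norm_num

theorem simplexSecondMoment_unitCube :
    simplexSecondMoment {x | ∀ i, x i ∈ Set.Icc (0:ℝ) 1} = 1 / 2592 := by
  have h : {x : EuclideanSpace ℝ (Fin 3) | ∀ i, x i ∈ Set.Icc (0:ℝ) 1}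
      = WithLp.ofLp ⁻¹' (Set.univ.pi fun _ : Fin 3 => Set.Icc (0:ℝ) 1) := by
    ext x
    simp only [Set.mem_ofPred_eq, Set.mem_preimage, Set.mem_univ_pi]
  rw [h, simplexSecondMoment_preimage_ofLp (isCompact_univ_pi fun _ => isCompact_Icc)]
  simp only [setIntegral_unitCube_prod_pow]
  trans 2 / 3 * Matrix.det (R := ℝ)
    !![1, 1 / 2, 1 / 2, 1 / 2; 1 / 2, 1 / 3, 1 / 4, 1 / 4;
      1 / 2, 1 / 4, 1 / 3, 1 / 4; 1 / 2, 1 / 4, 1 / 4, 1 / 3]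
  · congr 2
    ext i j
    fin_cases i <;> fin_cases j <;>
      norm_num [Fin.sum_univ_three, Fin.prod_univ_three, Fin.ext_iff]
  · simp [Matrix.det_succ_row_zero, Fin.sum_univ_succ, Fin.succAbove]
    norm_num

theorem simplexSecondMoment_tetrahedron {A B C D : EuclideanSpace ℝ (Fin 3)}
    (h : volume (convexHull ℝ {A, B, C, D}) = 1) :
    simplexSecondMoment (convexHull ℝ {A, B, C, D}) = 3 / 4000 := by
  have hdet := volume_convexHull_tetrahedron A B C D
  rw [h, ENNReal.toReal_one] at hdet
  have hdet6 : |LinearMap.det (tetrahedronMap A B C D).linear| = 6 := by linarith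
  have hne : LinearMap.det (tetrahedronMap A B C D).linear ≠ 0 := by
    intro h0
    norm_num [h0] at hdet6
  rw [← tetrahedronMap_image, simplexSecondMoment_image hne measurableSet_cornerTetrahedron,
    hdet6, simplexSecondMoment_cornerTetrahedron]
  norm_num

/-- The second moment of the volume of a random tetrahedron in a tetrahedron of volume 1
equals `3/4000`, and in the unit cube equals `1/2592`. -/
theorem stmt_9 :
    (∀ A B C D : EuclideanSpace ℝ (Fin 3), volume (convexHull ℝ {A, B, C, D}) = 1 →
      (∫ x₀ in convexHull ℝ {A, B, C, D}, ∫ x₁ in convexHull ℝ {A, B, C, D},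
          ∫ x₂ in convexHull ℝ {A, B, C, D}, ∫ x₃ in convexHull ℝ {A, B, C, D},
            (volume (convexHull ℝ {x₀, x₁, x₂, x₃})).toReal ^ 2)
        = 3 / 4000) ∧
    (∫ x₀ in {x : EuclideanSpace ℝ (Fin 3) | ∀ i, x i ∈ Set.Icc (0:ℝ) 1},
        ∫ x₁ in {x : EuclideanSpace ℝ (Fin 3) | ∀ i, x i ∈ Set.Icc (0:ℝ) 1},
          ∫ x₂ in {x : EuclideanSpace ℝ (Fin 3) | ∀ i, x i ∈ Set.Icc (0:ℝ) 1},
            ∫ x₃ in {x : EuclideanSpace ℝ (Fin 3) | ∀ i, x i ∈ Set.Icc (0:ℝ) 1},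
              (volume (convexHull ℝ {x₀, x₁, x₂, x₃})).toReal ^ 2)
      = 1 / 2592 := by
  exact ⟨fun _ _ _ _ h => simplexSecondMoment_tetrahedron h, simplexSecondMoment_unitCube⟩
end

section
/- The second moment of the volume of a random tetrahedron in a regular octahedron of volume 1 equals 3/8000. -/
open MeasureTheory Pointwise

/-- The cross-polytope `{x | ∑ |x i| ≤ r}` is the dilated hull of the signed basis vectors. -/
theorem smul_convexHull_signed_basis {r : ℝ} (hr : 0 < r) :
    r • convexHull ℝ ((Set.range fun i => EuclideanSpace.single i (1:ℝ)) ∪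
      (Set.range fun i : Fin 3 => -EuclideanSpace.single i (1:ℝ))) =
      {x : EuclideanSpace ℝ (Fin 3) | ∑ i, |x i| ≤ r} := by
  have key : convexHull ℝ ((Set.range fun i => EuclideanSpace.single i (1:ℝ)) ∪
      (Set.range fun i : Fin 3 => -EuclideanSpace.single i (1:ℝ))) =
      {x : EuclideanSpace ℝ (Fin 3) | ∑ i, |x i| ≤ 1} := by
    apply Set.Subset.antisymm
    · refine convexHull_min ?_ ?_
      · rintro _ (⟨i, rfl⟩ | ⟨i, rfl⟩) <;> fin_cases i <;>
          simp [Fin.sum_univ_three]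
      · intro x hx y hy a b ha hb hab
        simp only [Set.mem_ofPred_eq, Fin.sum_univ_three, PiLp.add_apply, PiLp.smul_apply,
          smul_eq_mul] at *
        have h : ∀ i, |a * x i + b * y i| ≤ a * |x i| + b * |y i| := fun i => by
          simpa [abs_mul, abs_of_nonneg ha, abs_of_nonneg hb] using abs_add_le (a * x i) (b * y i)
        nlinarith [h 0, h 1, h 2]
    · intro x hx
      rw [Set.mem_ofPred_eq, Fin.sum_univ_three] at hx
      let s := 1 - (|x 0| + |x 1| + |x 2|)
      have hs : 0 ≤ s := sub_nonneg.2 hx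
      have hmem := (convex_convexHull ℝ ((Set.range fun i => EuclideanSpace.single i (1:ℝ)) ∪
        (Set.range fun i : Fin 3 => -EuclideanSpace.single i (1:ℝ)))).sum_mem
        (t := Finset.univ)
        (w := Sum.elim (fun i => (|x i| + x i) / 2 + s / 6) (fun i => (|x i| - x i) / 2 + s / 6))
        (z := Sum.elim (fun i => EuclideanSpace.single i (1:ℝ))
          (fun i => -EuclideanSpace.single i (1:ℝ))) ?_ ?_ ?_
      · convert hmem using 1
        ext j
        fin_cases j <;>
          simp [Fin.sum_univ_three] <;> ring
      · rintro (i | i) -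
        · have := neg_abs_le (x i)
          simp only [Sum.elim_inl]; linarith
        · have := le_abs_self (x i)
          simp only [Sum.elim_inr]; linarith
      · simp [Fin.sum_univ_three, s]; ring
      · rintro (i | i) -
        · exact subset_convexHull _ _ (Or.inl ⟨i, rfl⟩)
        · exact subset_convexHull _ _ (Or.inr ⟨i, rfl⟩)
  rw [key]
  ext x
  rw [Set.mem_smul_set_iff_inv_smul_mem₀ hr.ne']
  simp only [Set.mem_ofPred_eq, PiLp.smul_apply, smul_eq_mul, abs_mul, ← Finset.mul_sum,
    abs_of_pos (inv_pos.2 hr)]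
  rw [inv_mul_le_iff₀ hr, mul_one]

/-- The corner simplex `{x ≥ 0 | ∑ x i ≤ s}` in dimension `n` has volume `s ^ n / n!`. -/
theorem volume_corner_simplex (n : ℕ) {s : ℝ} (hs : 0 ≤ s) :
    volume {x : Fin n → ℝ | (∀ i, 0 ≤ x i) ∧ ∑ i, x i ≤ s} =
      ENNReal.ofReal (s ^ n / n.factorial) := by
  induction n generalizing s with
  | zero => simp [hs, volume_pi]
  | succ n ih =>
    have hmeas (n : ℕ) (s : ℝ) :
        MeasurableSet {x : Fin n → ℝ | (∀ i, 0 ≤ x i) ∧ ∑ i, x i ≤ s} := by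
      simp only [Set.ofPred_and, Set.ofPred_forall]
      exact (MeasurableSet.iInter fun i =>
        measurableSet_le measurable_const (measurable_pi_apply i)).inter
        (measurableSet_le (by fun_prop) measurable_const)
    rw [← (volume_preserving_piFinSuccAbove (fun _ : Fin (n + 1) => ℝ) 0).symm.measure_preimage
      (hmeas _ _).nullMeasurableSet, Measure.volume_eq_prod,
      Measure.prod_apply ((MeasurableEquiv.measurable _) (hmeas _ _))]
    have hslice (t : ℝ) : volume (Prod.mk t ⁻¹'
        ((MeasurableEquiv.piFinSuccAbove (fun _ : Fin (n + 1) => ℝ) 0).symm ⁻¹'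
          {x | (∀ i, 0 ≤ x i) ∧ ∑ i, x i ≤ s})) =
        (Set.Icc 0 s).indicator (fun t => ENNReal.ofReal ((s - t) ^ n / n.factorial)) t := by
      by_cases ht : t ∈ Set.Icc 0 s
      · rw [Set.indicator_of_mem ht, ← ih (sub_nonneg.2 ht.2)]
        congr 1
        ext y
        simp [MeasurableEquiv.piFinSuccAbove, Fin.forall_fin_succ, Fin.sum_univ_succ, ht.1,
          le_sub_iff_add_le']
      · rw [Set.indicator_of_notMem ht]
        convert measure_empty (μ := (volume : Measure (Fin n → ℝ)))
        refine Set.eq_empty_of_forall_notMem fun y hy => ht ?_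
        simp only [MeasurableEquiv.piFinSuccAbove, Set.mem_preimage, Set.mem_ofPred_eq,
          Fin.forall_fin_succ, Fin.sum_univ_succ] at hy
        simp at hy
        exact ⟨hy.1.1, by linarith [Finset.sum_nonneg fun i (_ : i ∈ Finset.univ) => hy.1.2 i]⟩
    simp_rw [hslice]
    rw [lintegral_indicator measurableSet_Icc, ← ofReal_integral_eq_lintegral_ofReal,
      integral_Icc_eq_integral_Ioc, ← intervalIntegral.integral_of_le hs]
    · rw [intervalIntegral.integral_div, intervalIntegral.integral_comp_sub_left (fun x => x ^ n),
        integral_pow]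
      congr 1
      rw [Nat.factorial_succ]
      push_cast
      field_simp
      simp
    · exact (by fun_prop : Continuous _).integrableOn_Icc
    · filter_upwards [ae_restrict_mem measurableSet_Icc] with t ht
      have := sub_nonneg.2 ht.2
      positivity

/-- The volume of a tetrahedron is a sixth of the absolute determinant of its edge vectors. -/
theorem volume_tetrahedron_s10 (x₀ x₁ x₂ x₃ : EuclideanSpace ℝ (Fin 3)) :
    volume (convexHull ℝ {x₀, x₁, x₂, x₃}) =
      ENNReal.ofReal (|(Matrix.of ![(x₁ - x₀).ofLp, (x₂ - x₀).ofLp, (x₃ - x₀).ofLp]).det| / 6) := by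
  let M := (Matrix.of ![(x₁ - x₀).ofLp, (x₂ - x₀).ofLp, (x₃ - x₀).ofLp]).transpose
  let T : Set (EuclideanSpace ℝ (Fin 3)) := {t | (∀ i, 0 ≤ t i) ∧ ∑ i, t i ≤ 1}
  have hM (t) : M.toLpLin 2 2 t = t 0 • (x₁ - x₀) + t 1 • (x₂ - x₀) + t 2 • (x₃ - x₀) := by
    ext i
    simp [M, Matrix.mulVec, dotProduct, Fin.sum_univ_three]
    ring
  have hT : volume T = ENNReal.ofReal (1 / 6) := by
    have h := volume_corner_simplex 3 zero_le_one
    rw [← (EuclideanSpace.volume_preserving_symm_measurableEquiv_toLp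
      (Fin 3)).measure_preimage_equiv] at h
    refine h.trans ?_
    norm_num [Nat.factorial]
  have himage : convexHull ℝ {x₀, x₁, x₂, x₃} = x₀ +ᵥ (M.toLpLin 2 2 '' T) := by
    apply Set.Subset.antisymm
    · refine convexHull_min ?_ ?_
      · have h0 : (0 : EuclideanSpace ℝ (Fin 3)) ∈ T := by simp [T]
        have he (i) : EuclideanSpace.single i (1 : ℝ) ∈ T := by
          fin_cases i <;> simp [T, Fin.forall_fin_succ, Fin.sum_univ_three]
        have hmem {t} (ht : t ∈ T) : x₀ + M.toLpLin 2 2 t ∈ x₀ +ᵥ (M.toLpLin 2 2 '' T) :=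
          Set.vadd_mem_vadd_set (Set.mem_image_of_mem _ ht)
        rintro x (rfl | rfl | rfl | rfl)
        · simpa using hmem h0
        · simpa [hM] using hmem (he 0)
        · simpa [hM] using hmem (he 1)
        · simpa [hM] using hmem (he 2)
      · refine Convex.vadd (Convex.linear_image ?_ _) _
        intro x hx y hy a b ha hb hab
        have h1 := hx.1
        have h2 := hy.1
        refine ⟨fun i => ?_, ?_⟩
        · have := h1 i
          have := h2 i
          simp only [PiLp.add_apply, PiLp.smul_apply, smul_eq_mul]
          positivity
        · simp only [PiLp.add_apply, PiLp.smul_apply, smul_eq_mul, Finset.sum_add_distrib,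
            ← Finset.mul_sum]
          nlinarith [hx.2, hy.2]
    · rintro _ ⟨_, ⟨t, ⟨ht0, ht1⟩, rfl⟩, rfl⟩
      rw [Fin.sum_univ_three] at ht1
      have hmem := (convex_convexHull ℝ {x₀, x₁, x₂, x₃}).sum_mem (t := Finset.univ)
        (w := ![1 - (t 0 + t 1 + t 2), t 0, t 1, t 2]) (z := ![x₀, x₁, x₂, x₃]) ?_ ?_ ?_
      · convert hmem using 1
        simp only [hM, vadd_eq_add, Fin.sum_univ_four]
        simp
        module
      · simp [Fin.forall_fin_succ, ht0, ht1]
      · simp [Fin.sum_univ_four]; ring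
      · intro i _
        apply subset_convexHull
        fin_cases i <;> simp
  rw [himage, measure_vadd, Measure.addHaar_image_linearMap, hT, LinearMap.det_toLpLin,
    Matrix.det_transpose, ← ENNReal.ofReal_mul (abs_nonneg _)]
  congr 1
  ring

theorem isCompact_sum_abs_le (r : ℝ) :
    IsCompact {x : EuclideanSpace ℝ (Fin 3) | ∑ i, |x i| ≤ r} := by
  refine (isCompact_closedBall (0 : EuclideanSpace ℝ (Fin 3)) r).of_isClosed_subset
    (isClosed_le (by fun_prop) continuous_const) fun x hx => ?_
  rw [mem_closedBall_zero_iff]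
  refine le_trans ?_ hx
  rw [EuclideanSpace.norm_eq]
  refine Real.sqrt_le_iff.2 ⟨by positivity, ?_⟩
  simpa using Finset.sum_sq_le_sq_sum_of_nonneg (s := Finset.univ) (f := fun i => |x i|)
    fun i _ => abs_nonneg _

/-- The volume of the `n`-dimensional cross-polytope of radius `r`. -/
theorem volume_sum_abs_le (n : ℕ) [NeZero n] {r : ℝ} (hr : 0 ≤ r) :
    volume.real {x : Fin n → ℝ | ∑ i, |x i| ≤ r} = r ^ n * (2 ^ n / n.factorial) := by
  have h := volume_sum_rpow_le (Fin n) le_rfl r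
  simp only [Real.rpow_one, div_one, Fintype.card_fin] at h
  rw [Measure.real, h, show (1 : ℝ) + 1 = (1 : ℕ) + 1 by simp, Real.Gamma_nat_eq_factorial,
    Real.Gamma_nat_eq_factorial, ENNReal.toReal_mul, ENNReal.toReal_pow,
    ENNReal.toReal_ofReal hr, ENNReal.toReal_ofReal (by positivity)]
  simp

/-- Integrals over the octahedron of functions of one coordinate, by slicing. -/
theorem setIntegral_sum_abs_le_eval (r : ℝ) (hr : 0 ≤ r) {f : ℝ → ℝ} (hf : Continuous f)
    (i : Fin 3) :
    ∫ x in {x : EuclideanSpace ℝ (Fin 3) | ∑ i, |x i| ≤ r}, f (x i) =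
      ∫ t in (-r)..r, f t * (2 * (r - |t|) ^ 2) := by
  set S := {x : EuclideanSpace ℝ (Fin 3) | ∑ i, |x i| ≤ r} with hS
  let e := (MeasurableEquiv.piFinSuccAbove (fun _ : Fin 3 => ℝ) i).symm.trans
    (MeasurableEquiv.toLp 2 (Fin 3 → ℝ))
  have he : MeasurePreserving e :=
    (EuclideanSpace.volume_preserving_symm_measurableEquiv_toLp (Fin 3)).symm.comp
      (volume_preserving_piFinSuccAbove (fun _ : Fin 3 => ℝ) i).symm
  have hei (p) : e p i = p.1 :=
    Fin.insertNth_apply_same (α := fun _ => ℝ) i p.1 p.2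
  have hej (p) (j) : e p (i.succAbove j) = p.2 j :=
    Fin.insertNth_apply_succAbove (α := fun _ => ℝ) i p.1 p.2 j
  have heS : e ⁻¹' S = {p | |p.1| + ∑ j, |p.2 j| ≤ r} := by
    ext p
    simp only [hS, Set.mem_preimage, Set.mem_ofPred_eq, Fin.sum_univ_succAbove _ i, hei, hej]
  have hmeas : MeasurableSet (e ⁻¹' S) :=
    e.measurable (isCompact_sum_abs_le r).measurableSet
  have hint : IntegrableOn (fun x : EuclideanSpace ℝ (Fin 3) => f (x i)) S :=
    (by fun_prop : Continuous _).continuousOn.integrableOn_compact (isCompact_sum_abs_le r)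
  rw [← he.integrableOn_comp_preimage e.measurableEmbedding, Function.comp_def] at hint
  rw [← he.setIntegral_preimage_emb e.measurableEmbedding, ← integral_indicator hmeas,
    Measure.volume_eq_prod, integral_prod _ ((integrable_indicator_iff hmeas).2 hint),
    intervalIntegral.integral_of_le (by linarith), ← integral_Icc_eq_integral_Ioc,
    ← integral_indicator measurableSet_Icc]
  congr 1 with t
  have hslice (y : Fin 2 → ℝ) : (e ⁻¹' S).indicator (fun x => f (e x i)) (t, y) =
      {y : Fin 2 → ℝ | ∑ j, |y j| ≤ r - |t|}.indicator (fun _ => f t) y := by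
    simp only [heS, Set.indicator_apply, hei, Set.mem_ofPred_eq, le_sub_iff_add_le']
  simp_rw [hslice]
  rw [integral_indicator_const _ (measurableSet_le (by fun_prop) measurable_const)]
  by_cases ht : t ∈ Set.Icc (-r) r
  · rw [Set.indicator_of_mem ht, volume_sum_abs_le 2 (sub_nonneg.2 (abs_le.2 ht))]
    simp [Nat.factorial]
    ring
  · have hempty : {y : Fin 2 → ℝ | ∑ j, |y j| ≤ r - |t|} = ∅ := by
      refine Set.eq_empty_of_forall_notMem fun y hy => ht (abs_le.1 ?_)
      have hy' : ∑ j, |y j| ≤ r - |t| := hy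
      linarith [Finset.sum_nonneg fun j (_ : j ∈ Finset.univ) => abs_nonneg (y j)]
    rw [Set.indicator_of_notMem ht, hempty]
    simp

/-- Functions odd in one coordinate integrate to zero over the octahedron. -/
theorem setIntegral_sum_abs_le_eq_zero {r : ℝ} (i : Fin 3) {g : EuclideanSpace ℝ (Fin 3) → ℝ}
    (hg : ∀ x y : EuclideanSpace ℝ (Fin 3), y i = -x i → (∀ j ≠ i, y j = x j) → g y = -g x) :
    ∫ x in {x : EuclideanSpace ℝ (Fin 3) | ∑ i, |x i| ≤ r}, g x = 0 := by
  let e : EuclideanSpace ℝ (Fin 3) ≃ₗᵢ[ℝ] EuclideanSpace ℝ (Fin 3) :=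
    LinearIsometryEquiv.piLpCongrRight 2
      fun j => if j = i then LinearIsometryEquiv.neg ℝ else LinearIsometryEquiv.refl ℝ ℝ
  have hei (x) : e x i = -x i := by simp [e]
  have hej (x) (j) (hj : j ≠ i) : e x j = x j := by simp [e, hj]
  have h := e.measurePreserving.setIntegral_preimage_emb e.toMeasurableEquiv.measurableEmbedding g
    {x : EuclideanSpace ℝ (Fin 3) | ∑ i, |x i| ≤ r}
  have hpre : e ⁻¹' {x : EuclideanSpace ℝ (Fin 3) | ∑ i, |x i| ≤ r} =
      {x : EuclideanSpace ℝ (Fin 3) | ∑ i, |x i| ≤ r} := by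
    ext x
    have habs (j) : |e x j| = |x j| := by
      by_cases hj : j = i
      · rw [hj, hei, abs_neg]
      · rw [hej x j hj]
    simp [habs]
  simp_rw [hpre, hg _ _ (hei _) (hej _), integral_neg] at h
  linarith

/-- The integral of a quadratic polynomial over the octahedron of volume one. -/
theorem setIntegral_sum_abs_le_quadratic {r : ℝ} (hr : 0 ≤ r) (hr3 : r ^ 3 = 3 / 4)
    (c b₀ b₁ b₂ q₀₀ q₁₁ q₂₂ q₀₁ q₀₂ q₁₂ : ℝ) :
    ∫ x in {x : EuclideanSpace ℝ (Fin 3) | ∑ i, |x i| ≤ r},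
      (c + (b₀ * x 0 + b₁ * x 1 + b₂ * x 2)
        + (q₀₀ * x 0 ^ 2 + q₁₁ * x 1 ^ 2 + q₂₂ * x 2 ^ 2)
        + (q₀₁ * (x 0 * x 1) + q₀₂ * (x 0 * x 2) + q₁₂ * (x 1 * x 2))) =
      c + r ^ 2 / 10 * (q₀₀ + q₁₁ + q₂₂) := by
  have hint {g : EuclideanSpace ℝ (Fin 3) → ℝ} (hg : Continuous g) :
      IntegrableOn g {x : EuclideanSpace ℝ (Fin 3) | ∑ i, |x i| ≤ r} :=
    hg.continuousOn.integrableOn_compact (isCompact_sum_abs_le r)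
  have heven {g : ℝ → ℝ} (hg : Continuous g) (hg' : ∀ t, g (-t) = g t) :
      ∫ t in (-r)..r, g t = 2 * ∫ t in (0)..r, g t := by
    rw [← intervalIntegral.integral_add_adjacent_intervals (hg.intervalIntegrable (-r) 0)
      (hg.intervalIntegrable 0 r), two_mul]
    congr 1
    simpa [hg'] using (intervalIntegral.integral_comp_neg (a := 0) (b := r) g).symm
  have hconst (c : ℝ) : ∫ x in {x : EuclideanSpace ℝ (Fin 3) | ∑ i, |x i| ≤ r}, c = c := by
    rw [setIntegral_sum_abs_le_eval r hr (f := fun _ => c) continuous_const 0,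
      heven (by fun_prop) (by simp), intervalIntegral.integral_congr
        (g := fun t => c * 2 * (r - t) ^ 2)]
    · rw [intervalIntegral.integral_const_mul,
        intervalIntegral.integral_comp_sub_left (fun x => x ^ 2), integral_pow]
      norm_num [hr3]
      ring
    · intro t ht
      rw [Set.uIcc_of_le hr] at ht
      simp [abs_of_nonneg ht.1]
      ring
  have hsq (i : Fin 3) : ∫ x in {x : EuclideanSpace ℝ (Fin 3) | ∑ i, |x i| ≤ r}, x i ^ 2 =
      r ^ 2 / 10 := by
    rw [setIntegral_sum_abs_le_eval r hr (f := fun t => t ^ 2) (by fun_prop) i,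
      heven (by fun_prop) (by simp), intervalIntegral.integral_congr
        (g := fun t => 2 * r ^ 2 * t ^ 2 - 4 * r * t ^ 3 + 2 * t ^ 4)]
    · rw [intervalIntegral.integral_add, intervalIntegral.integral_sub]
      · simp only [intervalIntegral.integral_const_mul, integral_pow]
        norm_num
        linear_combination (2 / 15) * r ^ 2 * hr3
      all_goals exact (by fun_prop : Continuous _).intervalIntegrable _ _
    · intro t ht
      rw [Set.uIcc_of_le hr] at ht
      simp [abs_of_nonneg ht.1]
      ring
  have hlin (i : Fin 3) : ∫ x in {x : EuclideanSpace ℝ (Fin 3) | ∑ i, |x i| ≤ r}, x i = 0 :=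
    setIntegral_sum_abs_le_eq_zero i fun x y h _ => h
  have hmul (i j : Fin 3) (hij : j ≠ i) :
      ∫ x in {x : EuclideanSpace ℝ (Fin 3) | ∑ i, |x i| ≤ r}, x i * x j = 0 :=
    setIntegral_sum_abs_le_eq_zero i fun x y h h' => by rw [h, h' j hij]; ring
  rw [integral_add, integral_add, integral_add, integral_add, integral_add, integral_add,
    integral_add, integral_add, integral_add]
  · simp only [integral_const_mul, hconst, hsq, hlin, hmul 0 1 (by decide), hmul 0 2 (by decide),
      hmul 1 2 (by decide)]
    ring
  all_goals exact hint (by fun_prop)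

/-- The integral of a combination of squares of affine functions over the
octahedron of volume one. -/
theorem setIntegral_sum_abs_le_sum_sq {r : ℝ} (hr : 0 ≤ r) (hr3 : r ^ 3 = 3 / 4) {m : ℕ}
    (w c : Fin m → ℝ) (a : Fin m → Fin 3 → ℝ) :
    ∫ x in {x : EuclideanSpace ℝ (Fin 3) | ∑ i, |x i| ≤ r},
      ∑ k, w k * (c k + ∑ i, a k i * x i) ^ 2 =
      ∑ k, w k * (c k ^ 2 + r ^ 2 / 10 * ∑ i, a k i ^ 2) := by
  rw [integral_finsetSum]
  · refine Finset.sum_congr rfl fun k _ => ?_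
    rw [integral_const_mul]
    congr 1
    have h := setIntegral_sum_abs_le_quadratic hr hr3 (c k ^ 2) (2 * c k * a k 0)
      (2 * c k * a k 1) (2 * c k * a k 2) (a k 0 ^ 2) (a k 1 ^ 2) (a k 2 ^ 2)
      (2 * a k 0 * a k 1) (2 * a k 0 * a k 2) (2 * a k 1 * a k 2)
    rw [Fin.sum_univ_three, ← h]
    congr 1 with x
    rw [Fin.sum_univ_three]
    ring
  · exact fun k _ => (by fun_prop : Continuous _).continuousOn.integrableOn_compact
      (isCompact_sum_abs_le r)

/-- The second moment of the volume of a random tetrahedron in a regular octahedron of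
volume 1 equals `3/8000`.  Here the regular octahedron `conv(±e₁,±e₂,±e₃)` (of volume
`4/3`) is rescaled by the factor `(3/4)^{1/3}` so that it has volume 1. -/
theorem stmt_10 :
    (∫ x₀ in ((3/4 : ℝ) ^ ((1:ℝ)/3)) •
        convexHull ℝ ((Set.range fun i => EuclideanSpace.single i (1:ℝ)) ∪
          (Set.range fun i : Fin 3 => -EuclideanSpace.single i (1:ℝ))),
      ∫ x₁ in ((3/4 : ℝ) ^ ((1:ℝ)/3)) •
        convexHull ℝ ((Set.range fun i => EuclideanSpace.single i (1:ℝ)) ∪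
          (Set.range fun i : Fin 3 => -EuclideanSpace.single i (1:ℝ))),
      ∫ x₂ in ((3/4 : ℝ) ^ ((1:ℝ)/3)) •
        convexHull ℝ ((Set.range fun i => EuclideanSpace.single i (1:ℝ)) ∪
          (Set.range fun i : Fin 3 => -EuclideanSpace.single i (1:ℝ))),
      ∫ x₃ in ((3/4 : ℝ) ^ ((1:ℝ)/3)) •
        convexHull ℝ ((Set.range fun i => EuclideanSpace.single i (1:ℝ)) ∪
          (Set.range fun i : Fin 3 => -EuclideanSpace.single i (1:ℝ))),
        (volume (convexHull ℝ {x₀, x₁, x₂, x₃})).toReal ^ 2)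
      = 3 / 8000 := by
  have hr : (0 : ℝ) < (3 / 4 : ℝ) ^ ((1 : ℝ) / 3) := by positivity
  have hr3 : ((3 / 4 : ℝ) ^ ((1 : ℝ) / 3)) ^ 3 = 3 / 4 := by
    rw [← Real.rpow_natCast, ← Real.rpow_mul (by norm_num)]
    norm_num
  rw [smul_convexHull_signed_basis hr]
  generalize (3 / 4 : ℝ) ^ ((1 : ℝ) / 3) = r at hr hr3
  have hsq {m : ℕ} {F : EuclideanSpace ℝ (Fin 3) → ℝ} {V : ℝ}
      (w c : Fin m → ℝ) (a : Fin m → Fin 3 → ℝ)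
      (hF : ∀ x, F x = ∑ k, w k * (c k + ∑ i, a k i * x i) ^ 2)
      (hV : ∑ k, w k * (c k ^ 2 + r ^ 2 / 10 * ∑ i, a k i ^ 2) = V) :
      ∫ x in {x : EuclideanSpace ℝ (Fin 3) | ∑ i, |x i| ≤ r}, F x = V := by
    simp_rw [hF]
    rw [setIntegral_sum_abs_le_sum_sq hr.le hr3, hV]
  let N (v : Fin 3 → ℝ) : ℝ := v 0 ^ 2 + v 1 ^ 2 + v 2 ^ 2
  let κ := r ^ 2 / 10
  have h3 (x₀ x₁ x₂ : EuclideanSpace ℝ (Fin 3)) :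
      ∫ x₃ in {x : EuclideanSpace ℝ (Fin 3) | ∑ i, |x i| ≤ r},
        (volume (convexHull ℝ {x₀, x₁, x₂, x₃})).toReal ^ 2 =
      1 / 36 * ((crossProduct (x₁ - x₀).ofLp (x₂ - x₀).ofLp ⬝ᵥ x₀) ^ 2 +
        κ * N (crossProduct (x₁ - x₀).ofLp (x₂ - x₀).ofLp)) := by
    refine hsq ![1 / 36] ![-(crossProduct (x₁ - x₀).ofLp (x₂ - x₀).ofLp ⬝ᵥ x₀)]
      ![crossProduct (x₁ - x₀).ofLp (x₂ - x₀).ofLp] (fun x => ?_) ?_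
    · rw [volume_tetrahedron_s10, ENNReal.toReal_ofReal (by positivity), div_pow, sq_abs]
      simp [Matrix.det_fin_three, cross_apply, dotProduct, Fin.sum_univ_three]
      ring
    · simp [N, κ, Fin.sum_univ_three]
      ring
  have h2 (x₀ x₁ : EuclideanSpace ℝ (Fin 3)) :
      ∫ x₂ in {x : EuclideanSpace ℝ (Fin 3) | ∑ i, |x i| ≤ r},
        1 / 36 * ((crossProduct (x₁ - x₀).ofLp (x₂ - x₀).ofLp ⬝ᵥ x₀) ^ 2 +
          κ * N (crossProduct (x₁ - x₀).ofLp (x₂ - x₀).ofLp)) =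
      1 / 36 * (2 * κ * N (crossProduct x₁.ofLp x₀) + 2 * κ ^ 2 * N (x₁ - x₀).ofLp) := by
    refine hsq ![1 / 36, κ / 36, κ / 36, κ / 36]
      ![0, -crossProduct x₁.ofLp x₀ 0, -crossProduct x₁.ofLp x₀ 1, -crossProduct x₁.ofLp x₀ 2]
      ![-crossProduct x₁.ofLp x₀, ![0, -(x₁ 2 - x₀ 2), x₁ 1 - x₀ 1],
        ![x₁ 2 - x₀ 2, 0, -(x₁ 0 - x₀ 0)], ![-(x₁ 1 - x₀ 1), x₁ 0 - x₀ 0, 0]] (fun x => ?_) ?_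
    · simp [N, cross_apply, dotProduct, Fin.sum_univ_succ]
      ring
    · simp [N, κ, cross_apply, Fin.sum_univ_succ]
      ring
  have h1 (x₀ : EuclideanSpace ℝ (Fin 3)) :
      ∫ x₁ in {x : EuclideanSpace ℝ (Fin 3) | ∑ i, |x i| ≤ r},
        1 / 36 * (2 * κ * N (crossProduct x₁.ofLp x₀) + 2 * κ ^ 2 * N (x₁ - x₀).ofLp) =
      1 / 36 * (6 * κ ^ 2 * N x₀ + 6 * κ ^ 3) := by
    refine hsq ![κ / 18, κ / 18, κ / 18, κ ^ 2 / 18, κ ^ 2 / 18, κ ^ 2 / 18]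
      ![0, 0, 0, -x₀ 0, -x₀ 1, -x₀ 2]
      ![![0, x₀ 2, -x₀ 1], ![-x₀ 2, 0, x₀ 0], ![x₀ 1, -x₀ 0, 0], ![1, 0, 0], ![0, 1, 0],
        ![0, 0, 1]] (fun x => ?_) ?_
    · simp [N, cross_apply, Fin.sum_univ_succ]
      ring
    · simp [N, κ, Fin.sum_univ_succ]
      ring
  simp_rw [h3, h2, h1]
  refine hsq ![κ ^ 2 / 6, κ ^ 2 / 6, κ ^ 2 / 6, κ ^ 3 / 6] ![0, 0, 0, 1]
    ![![1, 0, 0], ![0, 1, 0], ![0, 0, 1], 0] (fun x => ?_) ?_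
  · simp [N, Fin.sum_univ_succ]
    ring
  · simp [κ, Fin.sum_univ_succ]
    linear_combination (r ^ 3 + 3 / 4) / 1500 * hr3
end
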